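/- arXiv:1608.02719 — 10 statements merged into one kernel-verified Lean document; each statement's English description precedes it below -/
import Mathlib

section
/- Consider the explicit flux-limited finite volume scheme for advection with velocity u > 0 at Courant number ν ∈ [0,1]: given cell values (c_j)_{j∈ℤ} and limiter values (φ_{j+1/2})_{j∈ℤ}, the numerical fluxes are c_{j+1/2} = c_j + (1/2)(1−ν)(c_{j+1}−c_j) φ_{j+1/2} and the update is c_j^{new} = c_j − ν(c_{j+1/2} − c_{j−1/2}). Suppose that for every j the limiter satisfies the division-free form of the bound 0 ≤ φ_{j+1/2} ≤ 2·minmod(1, r_{j+1/2}) with r_{j+1/2} = (c_j − c_{j−1})/(c_{j+1} − c_j), namely: 0 ≤ φ_{j+1/2} ≤ 2 and φ_{j+1/2}(c_{j+1} − c_j)² ≤ 2(c_j − c_{j−1})(c_{j+1} − c_j). Then the scheme satisfies the upwind maximum principle: for every j, min(c_j, c_{j−1}) ≤ c_j^{new} ≤ max(c_j, c_{j−1}). -/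
/-- The division-free minmod bound keeps the limited slope `φ * b` between `0` and twice the
nonnegative upwind slope `a`. -/
theorem limited_slope_mem_Icc {a b φ : ℝ} (ha : 0 ≤ a) (hφ : 0 ≤ φ)
    (h : φ * b ^ 2 ≤ 2 * a * b) : φ * b ∈ Set.Icc 0 (2 * a) := by
  rcases lt_trichotomy b 0 with hb | rfl | hb
  · have hφb : φ * b ^ 2 = 0 :=
      le_antisymm (h.trans (mul_nonpos_of_nonneg_of_nonpos (by linarith) hb.le)) (by positivity)
    have hφ_zero : φ = 0 := (mul_eq_zero.mp hφb).resolve_right (pow_ne_zero 2 hb.ne)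
    simp [hφ_zero, ha]
  · simp [ha]
  · exact ⟨by positivity, le_of_mul_le_mul_right (by linarith) hb⟩

/-- For a nonnegative upwind slope `a`, the flux-limited decrement lies between `0` and `a`. -/
theorem limited_decrement_mem_Icc {ν a b φ ψ : ℝ} (hν0 : 0 ≤ ν) (hν1 : ν ≤ 1) (ha : 0 ≤ a)
    (hφ : 0 ≤ φ) (h : φ * b ^ 2 ≤ 2 * a * b) (hψ0 : 0 ≤ ψ) (hψ2 : ψ ≤ 2) :
    ν * (a + (1 / 2) * (1 - ν) * (b * φ - a * ψ)) ∈ Set.Icc 0 a := by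
  obtain ⟨hp0, hp2⟩ := limited_slope_mem_Icc ha hφ h
  have hq0 : 0 ≤ a * ψ := mul_nonneg ha hψ0
  have hq2 : a * ψ ≤ a * 2 := mul_le_mul_of_nonneg_left hψ2 ha
  have hμ : 0 ≤ 1 - ν := sub_nonneg.mpr hν1
  have hlower : (1 - ν) * (-2 * a) ≤ (1 - ν) * (b * φ - a * ψ) :=
    mul_le_mul_of_nonneg_left (by linarith) hμ
  have hupper : (1 - ν) * (b * φ - a * ψ) ≤ (1 - ν) * (2 * a) :=
    mul_le_mul_of_nonneg_left (by linarith) hμ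
  constructor
  · exact mul_nonneg hν0 (by linarith [mul_nonneg hν0 ha])
  · calc ν * (a + (1 / 2) * (1 - ν) * (b * φ - a * ψ))
        ≤ ν * (a + (1 - ν) * a) := mul_le_mul_of_nonneg_left (by linarith) hν0
      _ ≤ a := by linarith [mul_nonneg (sq_nonneg (1 - ν)) ha]

/-- The flux-limited scheme with a limiter satisfying the
(division-free) bound `0 ≤ φ ≤ 2·minmod(1,r)` obeys the upwind maximum principle. -/
theorem fluxLimited_maximum_principle
    (ν : ℝ) (hν0 : 0 ≤ ν) (hν1 : ν ≤ 1)
    (c φ : ℤ → ℝ)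
    (hφ0 : ∀ j : ℤ, 0 ≤ φ j)
    (hφ2 : ∀ j : ℤ, φ j ≤ 2)
    (hφminmod : ∀ j : ℤ,
      φ j * (c (j + 1) - c j) ^ 2 ≤ 2 * (c j - c (j - 1)) * (c (j + 1) - c j))
    (F : ℤ → ℝ)
    (hF : ∀ j : ℤ, F j = c j + (1 / 2) * (1 - ν) * (c (j + 1) - c j) * φ j)
    (cnew : ℤ → ℝ)
    (hcnew : ∀ j : ℤ, cnew j = c j - ν * (F j - F (j - 1))) :
    ∀ j : ℤ, min (c j) (c (j - 1)) ≤ cnew j ∧ cnew j ≤ max (c j) (c (j - 1)) := by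
  intro j
  have hprev := hF (j - 1)
  rw [sub_add_cancel] at hprev
  have hnew : cnew j = c j - ν * ((c j - c (j - 1)) + (1 / 2) * (1 - ν) *
      ((c (j + 1) - c j) * φ j - (c j - c (j - 1)) * φ (j - 1))) := by
    rw [hcnew, hF, hprev]
    ring
  rcases le_total (c (j - 1)) (c j) with hle | hle
  · obtain ⟨h0, h1⟩ := limited_decrement_mem_Icc hν0 hν1 (sub_nonneg.mpr hle) (hφ0 j)
      (hφminmod j) (hφ0 (j - 1)) (hφ2 (j - 1))
    rw [min_eq_right hle, max_eq_left hle]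
    constructor <;> linarith
  · obtain ⟨h0, h1⟩ := limited_decrement_mem_Icc (b := c j - c (j + 1)) hν0 hν1
      (sub_nonneg.mpr hle) (hφ0 j) (by linarith [hφminmod j]) (hφ0 (j - 1)) (hφ2 (j - 1))
    rw [min_eq_left hle, max_eq_right hle]
    constructor <;> linarith
end

section
/- Let (c_j)_{j∈ℤ} be a finitely supported real sequence and let (φ_{j+1/2})_{j∈ℤ} be real numbers such that φ_{j+1/2} = 0 whenever c_{j+1} = c_j = c_{j-1} = 0 outside a finite set (so all sums below are finite). Define the semi-discrete fluxes F_j = c_j + (1/2)(c_{j+1} − c_j) φ_{j+1/2}. Then the following summation identity holds: Σ_{j∈ℤ} c_j (F_j − F_{j−1}) = (1/2) Σ_{j∈ℤ} (c_j − c_{j−1})² (1 − φ_{j−1/2}). -/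
/-- The sum over `ℤ` of the backward differences of a finitely supported function vanishes. -/
theorem finsum_sub_comp_sub_one_eq_zero {M : Type*} [AddCommGroup M] {g : ℤ → M}
    (hg : g.support.Finite) : ∑ᶠ j : ℤ, (g j - g (j - 1)) = 0 := by
  have hg' : (Function.support fun j => g (j - 1)).Finite :=
    hg.preimage (sub_left_injective (b := (1 : ℤ))).injOn
  rw [finsum_sub_distrib hg hg', sub_eq_zero]
  exact (finsum_comp_equiv (Equiv.subRight (1 : ℤ))).symm

/-- Summation-by-parts identity for the semi-discrete flux-limited scheme:
`Σ_j c_j (F_j − F_{j−1}) = (1/2) Σ_j (c_j − c_{j−1})² (1 − φ_{j−1/2})`,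
where `F_j = c_j + (1/2)(c_{j+1} − c_j) φ_{j+1/2}` (here `φ j` stands for `φ_{j+1/2}`). -/
theorem semidiscrete_summation_identity
    (c φ : ℤ → ℝ)
    (hc : (Function.support c).Finite)
    (hφ : ∃ S : Finset ℤ, ∀ j : ℤ, j ∉ S →
      (c (j - 1) = 0 ∧ c j = 0 ∧ c (j + 1) = 0) → φ j = 0)
    (F : ℤ → ℝ)
    (hF : ∀ j : ℤ, F j = c j + (1 / 2) * (c (j + 1) - c j) * φ j) :
    ∑ᶠ j : ℤ, c j * (F j - F (j - 1))
      = (1 / 2) * ∑ᶠ j : ℤ, (c j - c (j - 1)) ^ 2 * (1 - φ (j - 1)) := by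
  have hc' : (Function.support fun j => c (j - 1)).Finite :=
    hc.preimage (sub_left_injective (b := (1 : ℤ))).injOn
  set g : ℤ → ℝ := fun j => (1 / 2) * c j * (c j + (c (j + 1) - c j) * φ j) with hg_def
  have hg : g.support.Finite := hc.subset fun j hj hj0 => hj (by simp [hg_def, hj0])
  have hl : (Function.support fun j => c j * (F j - F (j - 1))).Finite :=
    hc.subset fun j hj hj0 => hj (by simp [hj0])
  have hr : (Function.support fun j => (c j - c (j - 1)) ^ 2 * (1 - φ (j - 1))).Finite := by
    refine (hc.union hc').subset fun j hj => ?_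
    by_contra h
    simp only [Set.mem_union, Function.mem_support, not_or, not_not] at h
    exact hj (by simp [h.1, h.2])
  have hr' : (Function.support fun j =>
      (1 / 2) * ((c j - c (j - 1)) ^ 2 * (1 - φ (j - 1)))).Finite :=
    hr.subset fun j hj hj0 => hj (by simp only [hj0, mul_zero])
  rw [mul_finsum, ← sub_eq_zero, ← finsum_sub_distrib hl hr',
    ← finsum_sub_comp_sub_one_eq_zero hg]
  refine finsum_congr fun j => ?_
  simp only [hg_def, hF, sub_add_cancel]
  ring
end

section
/- Let (c_j)_{j∈ℤ} be a finitely supported real sequence and let (φ_{j+1/2})_{j∈ℤ} satisfy 0 ≤ φ_{j+1/2} ≤ 1 for all j. Define the semi-discrete fluxes F_j = c_j + (1/2)(c_{j+1} − c_j) φ_{j+1/2}. Then Σ_{j∈ℤ} c_j (F_j − F_{j−1}) ≥ 0. Consequently, for u > 0 the semi-discrete scheme (d/dt) c_j(t) = −(u/Δx)(F_j(t) − F_{j−1}(t)) has non-increasing discrete L² norm Σ_j |c_j(t)|²; in particular this holds for the Minmod limiter flux F_j = c_j + (1/2) minmod(c_{j+1} − c_j, c_j − c_{j−1}), since minmod(1,r)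 ∈ [0,1] for all r. Hence such a scheme cannot sharpen (increase the L² norm of) a profile; a slope limiter that sharpens must take a value φ(r) > 1 for some r. -/
/-- The minmod function: `0` if `ab ≤ 0`, `min a b` if `a,b > 0`, `max a b` if `a,b < 0`. -/
noncomputable def minmod (a b : ℝ) : ℝ :=
  if a * b ≤ 0 then 0 else if 0 < a then min a b else max a b

/-- A telescoping sum of a finitely supported sequence vanishes. -/
theorem finsum_int_succ_sub_self {M : Type*} [AddCommGroup M] (a : ℤ → M)
    (ha : (Function.support a).Finite) : ∑ᶠ j : ℤ, (a (j + 1) - a j) = 0 := by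
  have hs : (Function.support fun j : ℤ => a (j + 1)).Finite :=
    ha.preimage (add_left_injective (1 : ℤ)).injOn
  rw [finsum_sub_distrib hs ha, sub_eq_zero]
  exact finsum_comp_equiv (Equiv.addRight (1 : ℤ))

/-- A sequence that dominates the increments of a finitely supported sequence has
nonnegative sum. -/
theorem finsum_nonneg_of_succ_sub_le (f a : ℤ → ℝ) (ha : (Function.support a).Finite)
    (hf : (Function.support f).Finite) (h : ∀ j, a (j + 1) - a j ≤ f j) :
    0 ≤ ∑ᶠ j : ℤ, f j := by
  have hs : (Function.support fun j : ℤ => a (j + 1) - a j).Finite :=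
    ((ha.preimage (add_left_injective (1 : ℤ)).injOn).union ha).subset
      (Function.support_sub (fun j : ℤ => a (j + 1)) a)
  rw [← finsum_int_succ_sub_self a ha, ← sub_nonneg, ← finsum_sub_distrib hf hs]
  exact finsum_nonneg fun j => sub_nonneg.2 (h j)

/-- Dissipation for a flux `H j = c j + δ j / 2` whose correction `δ j` does not exceed the
slope `c (j + 1) - c j` in the direction of that slope. -/
theorem finsum_mul_flux_sub_nonneg (c δ H : ℤ → ℝ) (hc : (Function.support c).Finite)
    (hH : ∀ j, H j = c j + (1 / 2) * δ j)
    (hδ : ∀ j, (c (j + 1) - c j) * δ j ≤ (c (j + 1) - c j) ^ 2) :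
    0 ≤ ∑ᶠ j : ℤ, c j * (H j - H (j - 1)) := by
  refine finsum_nonneg_of_succ_sub_le _ (fun j => c j * (H (j - 1) - c j / 2))
    (hc.subset (Function.support_mul_subset_left _ _))
    (hc.subset (Function.support_mul_subset_left _ _)) fun j => ?_
  simp only [add_sub_cancel_right]
  rw [hH j]
  linarith [hδ j]

theorem mul_minmod_le_sq (a b : ℝ) : a * minmod a b ≤ a ^ 2 := by
  unfold minmod
  split_ifs with h ha
  · simpa using sq_nonneg a
  · nlinarith [min_le_left a b]
  · nlinarith [le_max_left a b]

/-- For a limiter with `0 ≤ φ ≤ 1` the semi-discrete scheme dissipates the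
discrete L² norm: `Σ_j c_j (F_j − F_{j−1}) ≥ 0`; in particular this holds for the Minmod
limiter flux `G_j = c_j + (1/2)·minmod(c_{j+1} − c_j, c_j − c_{j−1})`.
(Hence such schemes cannot sharpen.) -/
theorem semidiscrete_L2_dissipation
    (c φ : ℤ → ℝ)
    (hc : (Function.support c).Finite)
    (hφ0 : ∀ j : ℤ, 0 ≤ φ j)
    (hφ1 : ∀ j : ℤ, φ j ≤ 1)
    (F : ℤ → ℝ)
    (hF : ∀ j : ℤ, F j = c j + (1 / 2) * (c (j + 1) - c j) * φ j)
    (G : ℤ → ℝ)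
    (hG : ∀ j : ℤ, G j = c j + (1 / 2) * minmod (c (j + 1) - c j) (c j - c (j - 1))) :
    0 ≤ ∑ᶠ j : ℤ, c j * (F j - F (j - 1)) ∧
    0 ≤ ∑ᶠ j : ℤ, c j * (G j - G (j - 1)) := by
  refine ⟨finsum_mul_flux_sub_nonneg c (fun j => (c (j + 1) - c j) * φ j) F hc
      (fun j => by rw [hF j]; ring) fun j => ?_,
    finsum_mul_flux_sub_nonneg c _ G hc hG fun j => mul_minmod_le_sq _ _⟩
  nlinarith [mul_le_mul_of_nonneg_left (hφ1 j) (sq_nonneg (c (j + 1) - c j))]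
end

section
/- Let u > 0, Δt > 0, Δx > 0 satisfy the CFL condition uΔt ≤ Δx, and let (c_j)_{j∈ℤ} be a real sequence. For each j set m_{j+1/2} = min(c_j, c_{j+1}), M_{j+1/2} = max(c_j, c_{j+1}), λ_{j+1/2} = (Δx/(uΔt))(c_j − M_{j−1/2}) + M_{j−1/2}, and Λ_{j+1/2} = (Δx/(uΔt))(c_j − m_{j−1/2}) + m_{j−1/2}. Then for every j one has λ_{j+1/2} ≤ Λ_{j+1/2}, and the upwind flux choice c_j belongs to the intersection of intervals [λ_{j+1/2}, Λ_{j+1/2}] ∩ [m_{j+1/2}, M_{j+1/2}]; in particular this intersection is nonempty. -/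
/-- Under the CFL condition `uΔt ≤ Δx`, one has `λ_{j+1/2} ≤ Λ_{j+1/2}` and the
upwind flux `c_j` belongs to `[λ_{j+1/2}, Λ_{j+1/2}] ∩ [m_{j+1/2}, M_{j+1/2}]`;
in particular this intersection is nonempty. -/
theorem upwind_flux_in_admissible_interval
    (u Δt Δx : ℝ) (hu : 0 < u) (hΔt : 0 < Δt) (hΔx : 0 < Δx)
    (hCFL : u * Δt ≤ Δx)
    (c : ℤ → ℝ)
    (m M lam Lam : ℤ → ℝ)
    (hm : ∀ j : ℤ, m j = min (c j) (c (j + 1)))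
    (hM : ∀ j : ℤ, M j = max (c j) (c (j + 1)))
    (hlam : ∀ j : ℤ, lam j = (Δx / (u * Δt)) * (c j - M (j - 1)) + M (j - 1))
    (hLam : ∀ j : ℤ, Lam j = (Δx / (u * Δt)) * (c j - m (j - 1)) + m (j - 1)) :
    ∀ j : ℤ, lam j ≤ Lam j ∧
      c j ∈ Set.Icc (lam j) (Lam j) ∩ Set.Icc (m j) (M j) ∧
      (Set.Icc (lam j) (Lam j) ∩ Set.Icc (m j) (M j)).Nonempty := by
  intro j
  have hr : 1 ≤ Δx / (u * Δt) := (one_le_div (mul_pos hu hΔt)).mpr hCFL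
  have hmc : m (j - 1) ≤ c j := by simp [hm]
  have hcM : c j ≤ M (j - 1) := by simp [hM]
  have h_lower : lam j ≤ c j := by
    rw [hlam]
    nlinarith [mul_nonneg (sub_nonneg.mpr hr) (sub_nonneg.mpr hcM)]
  have h_upper : c j ≤ Lam j := by
    rw [hLam]
    nlinarith [mul_nonneg (sub_nonneg.mpr hr) (sub_nonneg.mpr hmc)]
  have h_mem : c j ∈ Set.Icc (lam j) (Lam j) ∩ Set.Icc (m j) (M j) :=
    ⟨⟨h_lower, h_upper⟩, by simp [hm], by simp [hM]⟩
  exact ⟨h_lower.trans h_upper, h_mem, c j, h_mem⟩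
end

section
/- Let u > 0, Δt > 0, Δx > 0 satisfy the CFL condition uΔt ≤ Δx, set ν = uΔt/Δx, and let (c_j)_{j∈ℤ} be a real sequence. For each j set m_{j+1/2} = min(c_j, c_{j+1}), M_{j+1/2} = max(c_j, c_{j+1}), λ_{j+1/2} = (Δx/(uΔt))(c_j − M_{j−1/2}) + M_{j−1/2}, and Λ_{j+1/2} = (Δx/(uΔt))(c_j − m_{j−1/2}) + m_{j−1/2}. Suppose the numerical fluxes (c_{j+1/2})_{j∈ℤ} satisfy, for every j, c_{j+1/2} ∈ [λ_{j+1/2}, Λ_{j+1/2}] ∩ [m_{j+1/2}, M_{j+1/2}]. Then the updated values c_j^{new} = c_j − ν(c_{j+1/2} − c_{j−1/2}) satisfy the maximum principle: for every j, min(c_j, c_{j−1}) ≤ c_j^{new} ≤ max(c_j, c_{j−1}). -/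
/-- If every numerical flux `c_{j+1/2}` lies in the admissible interval
`[λ_{j+1/2}, Λ_{j+1/2}] ∩ [m_{j+1/2}, M_{j+1/2}]`, then the conservative update
`c_j^{new} = c_j − ν(c_{j+1/2} − c_{j−1/2})` satisfies the upwind maximum principle. -/
theorem limitedDownwind_maximum_principle
    (u Δt Δx : ℝ) (hu : 0 < u) (hΔt : 0 < Δt) (hΔx : 0 < Δx)
    (hCFL : u * Δt ≤ Δx)
    (ν : ℝ) (hν : ν = u * Δt / Δx)
    (c : ℤ → ℝ)
    (m M lam Lam : ℤ → ℝ)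
    (hm : ∀ j : ℤ, m j = min (c j) (c (j + 1)))
    (hM : ∀ j : ℤ, M j = max (c j) (c (j + 1)))
    (hlam : ∀ j : ℤ, lam j = (Δx / (u * Δt)) * (c j - M (j - 1)) + M (j - 1))
    (hLam : ∀ j : ℤ, Lam j = (Δx / (u * Δt)) * (c j - m (j - 1)) + m (j - 1))
    (flux : ℤ → ℝ)
    (hflux : ∀ j : ℤ, flux j ∈ Set.Icc (lam j) (Lam j) ∩ Set.Icc (m j) (M j))
    (cnew : ℤ → ℝ)
    (hcnew : ∀ j : ℤ, cnew j = c j - ν * (flux j - flux (j - 1))) :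
    ∀ j : ℤ, min (c j) (c (j - 1)) ≤ cnew j ∧ cnew j ≤ max (c j) (c (j - 1)) := by
  intro j
  have hs : 0 < u * Δt := mul_pos hu hΔt
  have hν_pos : 0 < ν := hν ▸ div_pos hs hΔx
  have hinv : ν * (Δx / (u * Δt)) = 1 := by
    rw [hν]
    field_simp
  obtain ⟨⟨hlow, hup⟩, -⟩ := hflux j
  obtain ⟨-, hmin, hmax⟩ := hflux (j - 1)
  have hlow' := mul_le_mul_of_nonneg_left hlow hν_pos.le
  have hup' := mul_le_mul_of_nonneg_left hup hν_pos.le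
  have hmin' := mul_le_mul_of_nonneg_left hmin hν_pos.le
  have hmax' := mul_le_mul_of_nonneg_left hmax hν_pos.le
  rw [hlam, mul_add, ← mul_assoc, hinv, one_mul] at hlow'
  rw [hLam, mul_add, ← mul_assoc, hinv, one_mul] at hup'
  have hm_eq : m (j - 1) = min (c j) (c (j - 1)) := by
    rw [hm, sub_add_cancel, min_comm]
  have hM_eq : M (j - 1) = max (c j) (c (j - 1)) := by
    rw [hM, sub_add_cancel, max_comm]
  rw [← hm_eq, ← hM_eq, hcnew]
  constructor <;> linarith
end

section
/- Let u > 0 and 0 < ν < 1, and let (c_j)_{j∈ℤ} be a real sequence with c_{j+1} ≠ c_j for a given j. Set m_{j+1/2} = min(c_j, c_{j+1}), M_{j+1/2} = max(c_j, c_{j+1}), λ_{j+1/2} = (1/ν)(c_j − M_{j−1/2}) + M_{j−1/2}, Λ_{j+1/2} = (1/ν)(c_j − m_{j−1/2}) + m_{j−1/2}, and let [ω_{j+1/2}, Ω_{j+1/2}] = [λ_{j+1/2}, Λ_{j+1/2}] ∩ [m_{j+1/2}, M_{j+1/2}]. Define the limited downwind flux as the projection of the downwind value onto this interval: c_{j+1/2}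 = Ω_{j+1/2} if c_{j+1} ≥ Ω_{j+1/2}, c_{j+1/2} = c_{j+1} if ω_{j+1/2} ≤ c_{j+1} ≤ Ω_{j+1/2}, and c_{j+1/2} = ω_{j+1/2} if c_{j+1} ≤ ω_{j+1/2}. Then this flux coincides with the UltraBee limiter flux: c_{j+1/2} = c_j + (1/2)(1−ν) φ(r_{j+1/2}, ν)(c_{j+1} − c_j), where r_{j+1/2} = (c_j − c_{j−1})/(c_{j+1} − c_j) and φ(r, ν) = minmod(2r/ν, 2/(1−ν)). -/
theorem minmod_of_mul_nonpos {a b : ℝ} (h : a * b ≤ 0) : minmod a b = 0 := if_pos h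

theorem minmod_of_pos {a b : ℝ} (ha : 0 < a) (hb : 0 < b) : minmod a b = min a b := by
  rw [minmod, if_neg (mul_pos ha hb).not_ge, if_pos ha]

/-- The UltraBee anti-diffusive correction vanishes at extrema. -/
theorem ultraBee_correction_of_mul_nonpos {ν x y : ℝ} (hν0 : 0 < ν) (hν1 : ν < 1)
    (h : x * y ≤ 0) :
    (1 / 2) * (1 - ν) * minmod (2 * (x / y) / ν) (2 / (1 - ν)) * y = 0 := by
  have hr : x / y ≤ 0 := by
    rcases mul_nonpos_iff.mp h with ⟨hx, hy⟩ | ⟨hx, hy⟩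
    · exact div_nonpos_of_nonneg_of_nonpos hx hy
    · exact div_nonpos_of_nonpos_of_nonneg hx hy
  rw [minmod_of_mul_nonpos, mul_zero, zero_mul]
  exact mul_nonpos_of_nonpos_of_nonneg
    (div_nonpos_of_nonpos_of_nonneg (by linarith) hν0.le)
    (div_nonneg zero_le_two (by linarith))

/-- Away from extrema the UltraBee anti-diffusive correction is the smaller of the two slopes. -/
theorem ultraBee_correction_of_mul_pos {ν x y : ℝ} (hν0 : 0 < ν) (hν1 : ν < 1)
    (h : 0 < x * y) :
    (1 / 2) * (1 - ν) * minmod (2 * (x / y) / ν) (2 / (1 - ν)) * y =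
      min ((1 / ν - 1) * (x / y)) 1 * y := by
  have hν : 0 < 1 - ν := sub_pos.mpr hν1
  have hr : 0 < x / y := by
    rcases mul_pos_iff.mp h with ⟨hx, hy⟩ | ⟨hx, hy⟩
    · exact div_pos hx hy
    · exact div_pos_of_neg_of_neg hx hy
  rw [minmod_of_pos (by positivity) (by positivity), mul_min_of_nonneg _ _ (by positivity)]
  congr 2
  · field_simp
  · field_simp

/-- the limited downwind flux (projection of the downwind value onto
`[λ_{j+1/2}, Λ_{j+1/2}] ∩ [m_{j+1/2}, M_{j+1/2}] = [ω_{j+1/2}, Ω_{j+1/2}]`)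
coincides with the UltraBee limiter flux
`c_j + (1/2)(1−ν) φ(r,ν)(c_{j+1}−c_j)` with `φ(r,ν) = minmod(2r/ν, 2/(1−ν))`. -/
theorem limitedDownwind_eq_ultraBee
    (u ν : ℝ) (hu : 0 < u) (hν0 : 0 < ν) (hν1 : ν < 1)
    (c : ℤ → ℝ) (j : ℤ) (hne : c (j + 1) ≠ c j)
    (m M : ℤ → ℝ)
    (hm : ∀ i : ℤ, m i = min (c i) (c (i + 1)))
    (hM : ∀ i : ℤ, M i = max (c i) (c (i + 1)))
    (lam Lam ω Ω flux r : ℝ)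
    (hlam : lam = (1 / ν) * (c j - M (j - 1)) + M (j - 1))
    (hLam : Lam = (1 / ν) * (c j - m (j - 1)) + m (j - 1))
    (hωΩ : Set.Icc ω Ω = Set.Icc lam Lam ∩ Set.Icc (m j) (M j))
    (hflux : flux = if Ω ≤ c (j + 1) then Ω
      else if c (j + 1) ≤ ω then ω else c (j + 1))
    (hr : r = (c j - c (j - 1)) / (c (j + 1) - c j)) :
    flux = c j + (1 / 2) * (1 - ν) * minmod (2 * r / ν) (2 / (1 - ν)) * (c (j + 1) - c j) := by
  have hK : 0 < 1 / ν - 1 := by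
    rw [sub_pos, lt_div_iff₀ hν0]
    linarith
  rw [hm, hM, Set.Icc_inter_Icc] at hωΩ
  rw [hM, sub_add_cancel] at hlam
  rw [hm, sub_add_cancel] at hLam
  subst hr
  generalize c (j - 1) = a at *
  generalize c j = b at *
  generalize c (j + 1) = d at *
  have hlam' : lam = b + (1 / ν - 1) * min (b - a) 0 := by
    rcases le_total a b with h | h
    · rw [hlam, max_eq_right h, min_eq_right (by linarith)]
      ring
    · rw [hlam, max_eq_left h, min_eq_left (by linarith)]
      ring
  have hLam' : Lam = b + (1 / ν - 1) * max (b - a) 0 := by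
    rcases le_total a b with h | h
    · rw [hLam, min_eq_left h, max_eq_left (by linarith)]
      ring
    · rw [hLam, min_eq_right h, max_eq_right (by linarith)]
      ring
  have hlam_le : lam ≤ b := by
    have := mul_nonpos_of_nonneg_of_nonpos hK.le (min_le_right (b - a) 0)
    linarith
  have hle_Lam : b ≤ Lam := by
    have := mul_nonneg hK.le (le_max_right (b - a) 0)
    linarith
  have hωb : b ∈ Set.Icc ω Ω := by
    rw [hωΩ]
    exact ⟨sup_le hlam_le (min_le_left _ _), le_inf hle_Lam (le_max_left _ _)⟩
  have hωle : ω ≤ Ω := hωb.1.trans hωb.2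
  have hle : max lam (min b d) ≤ min Lam (max b d) := Set.nonempty_Icc.mp (hωΩ ▸ ⟨b, hωb⟩)
  have hω : ω = max lam (min b d) := by
    rw [← csInf_Icc hωle, hωΩ]
    exact csInf_Icc hle
  have hΩ : Ω = min Lam (max b d) := by
    rw [← csSup_Icc hωle, hωΩ]
    exact csSup_Icc hle
  rcases lt_or_gt_of_ne hne with hd | hd
  · have hω' : ω = max lam d := by rw [hω, min_eq_right hd.le]
    have hflux' : flux = ω := by
      rw [hflux, if_neg (by linarith [hωb.2]), if_pos (hω' ▸ le_max_right _ _)]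
    rw [hflux', hω', hlam']
    rcases le_or_gt a b with h | h
    · rw [ultraBee_correction_of_mul_nonpos hν0 hν1
        (mul_nonpos_of_nonneg_of_nonpos (sub_nonneg.mpr h) (sub_neg.mpr hd).le),
        min_eq_right (by linarith), mul_zero, add_zero, max_eq_left hd.le]
    · have hy : d - b < 0 := sub_neg.mpr hd
      rw [ultraBee_correction_of_mul_pos hν0 hν1 (mul_pos_of_neg_of_neg (sub_neg.mpr h) hy),
        min_eq_left (by linarith), (antitone_mul_right hy.le).map_min, one_mul, mul_assoc,
        div_mul_cancel₀ _ hy.ne, ← max_add_add_left, add_sub_cancel]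
  · have hΩ' : Ω = min Lam d := by rw [hΩ, max_eq_right hd.le]
    have hflux' : flux = Ω := by
      rw [hflux, if_pos (hΩ' ▸ min_le_right _ _)]
    rw [hflux', hΩ', hLam']
    rcases le_or_gt b a with h | h
    · rw [ultraBee_correction_of_mul_nonpos hν0 hν1
        (mul_nonpos_of_nonpos_of_nonneg (sub_nonpos.mpr h) (sub_pos.mpr hd).le),
        max_eq_right (by linarith), mul_zero, add_zero, min_eq_left hd.le]
    · have hy : 0 < d - b := sub_pos.mpr hd
      rw [ultraBee_correction_of_mul_pos hν0 hν1 (mul_pos (sub_pos.mpr h) hy),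
        max_eq_left (by linarith), min_mul_of_nonneg _ _ hy.le, one_mul, mul_assoc,
        div_mul_cancel₀ _ hy.ne', ← min_add_add_left, add_sub_cancel]
end

section
/- The limited downwind scheme is exact for step initial conditions: let u > 0, Δt, Δx > 0 with ν = uΔt/Δx ∈ (0,1), let a, b, x₀ ∈ ℝ, and define the exact cell averages e_j^n = (1/Δx) ∫_{(j−1/2)Δx}^{(j+1/2)Δx} (a + (b−a) H(x − x₀ − u n Δt)) dx, where H is the Heaviside function (indicator of (0,∞)). If the discrete values are initialized as c_j^0 = e_j^0 and evolved by the limited downwind scheme c_j^{n+1} = c_j^n − ν(c_{j+1/2}^n − c_{j−1/2}^n), with flux c_{j+1/2}^n equal to the projection of the downwind value c_{j+1}^n onto the interval [λ_{j+1/2}^n, Λ_{j+1/2}^n] ∩ [m_{j+1/2}^n, M_{j+1/2}^n], then for every n ≥ 0 and every j ∈ ℤ, c_j^n = e_j^n; that is, the numerical solution coincides at every time step with the cell averages of the exactly transported step function. -/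
open MeasureTheory in
/-- The integral of a shifted Heaviside function over `[p, q]`. -/
theorem integral_heaviside {p q : ℝ} (hpq : p ≤ q) (y : ℝ) :
    ∫ x in p..q, (if 0 < x - y then (1 : ℝ) else 0) = max 0 (min (q - y) (q - p)) := by
  have h : (fun x : ℝ => if 0 < x - y then (1 : ℝ) else 0) =
      (Set.Ioi y).indicator (fun _ => (1 : ℝ)) := by
    ext x
    simp [Set.indicator_apply]
  rw [h, intervalIntegral.integral_of_le hpq, setIntegral_indicator measurableSet_Ioi,
    Set.Ioc_inter_Ioi, setIntegral_const, Measure.real, Real.volume_Ioc,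
    ENNReal.toReal_ofReal', smul_eq_mul, mul_one, max_comm, ← min_sub_sub_left, min_comm]

open MeasureTheory in
theorem intervalIntegrable_heaviside (p q y : ℝ) :
    IntervalIntegrable (fun x : ℝ => if 0 < x - y then (1 : ℝ) else 0) volume p q := by
  refine Monotone.intervalIntegrable fun x z hxz => ?_
  split_ifs <;> linarith

/-- The truncation of `t` to `[0, 1]`: the fraction of a cell lying to the right of a point at
signed distance `t` (in cell widths) to the left of the right end of the cell. -/
def clampUnit (t : ℝ) : ℝ := max 0 (min t 1)

theorem clampUnit_of_nonpos {t : ℝ} (h : t ≤ 0) : clampUnit t = 0 :=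
  max_eq_left ((min_le_left _ _).trans h)

theorem clampUnit_of_one_le {t : ℝ} (h : 1 ≤ t) : clampUnit t = 1 := by
  simp [clampUnit, h]

theorem clampUnit_of_mem {t : ℝ} (h0 : 0 ≤ t) (h1 : t ≤ 1) : clampUnit t = t := by
  simp [clampUnit, h0, h1]

/-- The cell average of a step function located at `y`. -/
theorem cellAverage_step {h : ℝ} (hh : 0 < h) (a b y r : ℝ) :
    (1 / h) * ∫ x in ((r - 1 / 2) * h)..((r + 1 / 2) * h),
      (a + (b - a) * (if 0 < x - y then 1 else 0)) =
    a + (b - a) * clampUnit (r + 1 / 2 - y / h) := by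
  have hpq : (r - 1 / 2) * h ≤ (r + 1 / 2) * h := by nlinarith
  have hlen : (r + 1 / 2) * h - (r - 1 / 2) * h = h * 1 := by ring
  have hdist : (r + 1 / 2) * h - y = h * (r + 1 / 2 - y / h) := by field_simp
  rw [intervalIntegral.integral_add intervalIntegrable_const
      ((intervalIntegrable_heaviside _ _ y).const_mul _),
    intervalIntegral.integral_const, intervalIntegral.integral_const_mul,
    integral_heaviside hpq, hlen, hdist, ← mul_min_of_nonneg _ _ hh.le, clampUnit]
  have hmax : max 0 (h * min (r + 1 / 2 - y / h) 1) =
      h * max 0 (min (r + 1 / 2 - y / h) 1) := by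
    rw [mul_max_of_nonneg _ _ hh.le, mul_zero]
  rw [hmax, smul_eq_mul]
  field_simp

/-- The exact transport of cell averages of a unit step. -/
theorem clampUnit_sub {ν : ℝ} (hν0 : 0 < ν) (hν1 : ν < 1) (t : ℝ) :
    clampUnit (t - ν) =
      clampUnit t - ν * (clampUnit (t / ν) - clampUnit ((t - 1) / ν)) := by
  have hscale : ∀ s : ℝ, ν * clampUnit (s / ν) = max 0 (min s ν) := fun s => by
    rw [clampUnit, mul_max_of_nonneg _ _ hν0.le, mul_min_of_nonneg _ _ hν0.le,
      mul_div_cancel₀ _ hν0.ne', mul_zero, mul_one]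
  rw [mul_sub, hscale, hscale]
  simp only [clampUnit]
  grind

/-- The limited downwind flux for cell averages of a step. -/
theorem limitedDownwind_flux_step {ν : ℝ} (hν0 : 0 < ν) (hν1 : ν < 1) (a b t : ℝ)
    {p q w : ℝ} (hp : p = a + (b - a) * clampUnit (t - 1))
    (hq : q = a + (b - a) * clampUnit t) (hw : w = a + (b - a) * clampUnit (t + 1)) :
    max (max ((1 / ν) * (q - max p q) + max p q) (min q w))
      (min w (min ((1 / ν) * (q - min p q) + min p q) (max q w))) =
    a + (b - a) * clampUnit (t / ν) := by
  have hν : 1 ≤ 1 / ν := (one_le_div hν0).2 hν1.le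
  rcases le_total t 0 with h0 | h0
  · rw [clampUnit_of_nonpos (by linarith), mul_zero, add_zero] at hp hq
    rw [clampUnit_of_nonpos (div_nonpos_of_nonpos_of_nonneg h0 hν0.le), hp, hq]
    simp
  rcases le_total 1 t with h1 | h1
  · rw [clampUnit_of_one_le (by linarith)] at hq hw
    obtain rfl : q = b := by linarith
    obtain rfl : w = q := by linarith
    have hlam : (1 / ν) * (w - max p w) + max p w ≤ w := by
      nlinarith [le_max_right p w]
    rw [clampUnit_of_one_le ((one_le_div hν0).2 (by linarith)), min_self,
      max_eq_right hlam, max_eq_left (min_le_left _ _)]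
    ring
  · rw [clampUnit_of_nonpos (by linarith), mul_zero, add_zero] at hp
    rw [clampUnit_of_mem h0 h1] at hq
    rw [clampUnit_of_one_le (by linarith)] at hw
    obtain rfl : w = b := by linarith
    subst hp
    have htν : t ≤ t / ν := by rw [le_div_iff₀ hν0]; nlinarith
    have hend : (1 / ν) * (q - p) + p = p + (w - p) * (t / ν) := by rw [hq]; ring
    have hclamp : clampUnit (t / ν) = min (t / ν) 1 := max_eq_right (by positivity)
    rw [hclamp]
    rcases le_total p w with hd | hd
    · have hpq : p ≤ q := by nlinarith
      have hqw : q ≤ w := by nlinarith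
      have hq' : q ≤ p + (w - p) * (t / ν) := by nlinarith
      rw [max_eq_right hpq, min_eq_left hpq, min_eq_left hqw, max_eq_right hqw, hend,
        mul_min_of_nonneg _ _ (sub_nonneg.2 hd)]
      grind
    · have hpq : q ≤ p := by nlinarith
      have hqw : w ≤ q := by nlinarith
      rw [max_eq_left hpq, min_eq_right hpq, min_eq_right hqw, max_eq_left hqw, hend,
        (antitone_mul_left (sub_nonpos.2 hd)).map_min]
      grind


/-- the limited downwind scheme is exact for step initial conditions:
initialized with the cell averages of `a + (b−a)H(x − x₀)` and evolved with the
limited downwind flux (projection of the downwind value onto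
`[λ_{j+1/2}, Λ_{j+1/2}] ∩ [m_{j+1/2}, M_{j+1/2}]`), the discrete solution equals at
every time step the cell averages of the exactly transported step function. -/
theorem limitedDownwind_exact_for_steps
    (u Δt Δx : ℝ) (hu : 0 < u) (hΔt : 0 < Δt) (hΔx : 0 < Δx)
    (ν : ℝ) (hν : ν = u * Δt / Δx) (hν0 : 0 < ν) (hν1 : ν < 1)
    (a b x₀ : ℝ)
    (e : ℕ → ℤ → ℝ)
    (he : ∀ n : ℕ, ∀ j : ℤ, e n j = (1 / Δx) *
      ∫ x in (((j : ℝ) - 1 / 2) * Δx)..(((j : ℝ) + 1 / 2) * Δx),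
        (a + (b - a) * (if 0 < x - x₀ - u * (n : ℝ) * Δt then 1 else 0)))
    (c : ℕ → ℤ → ℝ)
    (hc0 : ∀ j : ℤ, c 0 j = e 0 j)
    (m M lam Lam ω Ω F : ℕ → ℤ → ℝ)
    (hm : ∀ n j, m n j = min (c n j) (c n (j + 1)))
    (hM : ∀ n j, M n j = max (c n j) (c n (j + 1)))
    (hlam : ∀ n j, lam n j = (1 / ν) * (c n j - M n (j - 1)) + M n (j - 1))
    (hLam : ∀ n j, Lam n j = (1 / ν) * (c n j - m n (j - 1)) + m n (j - 1))
    (hω : ∀ n j, ω n j = max (lam n j) (m n j))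
    (hΩ : ∀ n j, Ω n j = min (Lam n j) (M n j))
    (hF : ∀ n j, F n j = max (ω n j) (min (c n (j + 1)) (Ω n j)))
    (hrec : ∀ n j, c (n + 1) j = c n j - ν * (F n j - F n (j - 1))) :
    ∀ n : ℕ, ∀ j : ℤ, c n j = e n j := by
  have he' : ∀ n j, e n j =
      a + (b - a) * clampUnit ((j : ℝ) + 1 / 2 - (x₀ + u * n * Δt) / Δx) := fun n j => by
    rw [he, ← cellAverage_step hΔx]
    simp only [sub_sub]
  intro n
  induction n with
  | zero => exact hc0
  | succ n ih =>
    have hflux : ∀ j, F n j =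
        a + (b - a) * clampUnit (((j : ℝ) + 1 / 2 - (x₀ + u * n * Δt) / Δx) / ν) := fun j => by
      rw [hF, hω, hΩ, hlam, hLam, hm, hM, hm, hM, sub_add_cancel]
      refine limitedDownwind_flux_step hν0 hν1 a b _ ?_ ?_ ?_ <;> rw [ih, he']
      · push_cast
        ring_nf
      · push_cast
        ring_nf
    intro j
    have hshift : (j : ℝ) + 1 / 2 - (x₀ + u * ((n + 1 : ℕ) : ℝ) * Δt) / Δx =
        (j : ℝ) + 1 / 2 - (x₀ + u * n * Δt) / Δx - ν := by
      rw [hν]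
      push_cast
      ring
    have hprev : ((j - 1 : ℤ) : ℝ) + 1 / 2 - (x₀ + u * n * Δt) / Δx =
        (j : ℝ) + 1 / 2 - (x₀ + u * n * Δt) / Δx - 1 := by
      push_cast
      ring
    rw [hrec, hflux, hflux, ih, he', he', hshift, hprev, clampUnit_sub hν0 hν1]
    ring
end

section
/- (Iserles–Strang order barrier.) Let p ≥ 1 and k ≥ 0 be integers with p ≤ p + 1 coefficients on the stencil {k−p, …, k}, and for each ν ∈ (0,1] let α_{k−p}(ν), …, α_k(ν) be the unique real coefficients satisfying the order-p conditions Σ_{r=k−p}^{k} α_r(ν) r^m = (−ν)^m for all m = 0, 1, …, p (these coefficients exist and are unique since the conditions form a Vandermonde system). Then the associated linear scheme (Hc)_j = Σ_{r=k−p}^{k} α_r(ν) c_{j+r} has non-increasing ℓ²(ℤ) norm, i.e. ‖Hc‖_{ℓ²} ≤ ‖c‖_{ℓ²} for every c ∈ ℓ²(ℤ), for all ν ∈ (0,1], if and only if p ∈ {2k, 2k+1, 2k+2}. -/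
namespace IserlesStrang
open Polynomial Finset

/-- The weights `f 0, …, f p` at the nodes `0, …, p` reproduce the value at `y` of every
polynomial of degree at most `p`. -/
def Reproduces (p : ℕ) (f : ℕ → ℝ) (y : ℝ) : Prop :=
  ∀ P : ℝ[X], P.natDegree ≤ p → ∑ i ∈ range (p + 1), f i * P.eval (i : ℝ) = P.eval y

theorem sum_Icc_int_eq_sum_range {M : Type*} [AddCommMonoid M] (a : ℤ) (p : ℕ) (g : ℤ → M) :
    ∑ r ∈ Icc a (a + p), g r = ∑ i ∈ range (p + 1), g (a + i) := by
  symm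
  refine sum_bij (fun i _ => a + (i : ℤ)) ?_ ?_ ?_ ?_
  · intro i hi
    simp only [mem_range, mem_Icc] at hi ⊢
    omega
  · intro i _ j _ h
    simpa using h
  · intro r hr
    simp only [mem_Icc] at hr
    exact ⟨(r - a).toNat, by simp only [mem_range]; omega, by omega⟩
  · intro i _
    rfl

theorem reproduces_of_moments {p : ℕ} {a : ℤ} {w : ℤ → ℝ} {x : ℝ}
    (h : ∀ m ≤ p, ∑ r ∈ Icc a (a + p), w r * (r : ℝ) ^ m = x ^ m) :
    Reproduces p (fun i => w (a + i)) (x - a) := by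
  intro P hP
  set R : ℝ[X] := P.comp (X - C (a : ℝ)) with hR
  have hdeg : R.natDegree < p + 1 := by
    rw [hR, natDegree_comp, natDegree_X_sub_C, mul_one]
    omega
  have hev : ∀ z : ℝ, R.eval z = P.eval (z - a) := fun z => by simp [hR]
  have key : ∑ r ∈ Icc a (a + p), w r * R.eval (r : ℝ) = R.eval x := by
    simp_rw [eval_eq_sum_range' hdeg, mul_sum]
    rw [sum_comm]
    refine sum_congr rfl fun m hm => ?_
    rw [← h m (by simpa [Nat.lt_succ_iff] using hm), mul_sum]
    exact sum_congr rfl fun r _ => by ring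
  rw [sum_Icc_int_eq_sum_range, hev] at key
  rw [← key]
  refine sum_congr rfl fun i _ => ?_
  rw [hev]
  push_cast
  ring_nf

/-- The defect `∑ f i (i - y) z ^ i` of the symbol is a multiple of `(z - 1) ^ p`. -/
theorem Reproduces.sum_defect {p : ℕ} {f : ℕ → ℝ} {y : ℝ} (h : Reproduces p f y) (z : ℂ) :
    ∑ i ∈ range (p + 1), ((f i * (i - y) : ℝ) : ℂ) * z ^ i
      = ((f p * (p - y) : ℝ) : ℂ) * (z - 1) ^ p := by
  have hmom : ∀ m < p, ∑ i ∈ range (p + 1), f i * (i - y) * (i.choose m : ℝ) = 0 := by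
    intro m hm
    have h1 := h ((X - C y) * descPochhammer ℝ m) (by
      refine natDegree_mul_le.trans ?_
      rw [natDegree_X_sub_C, descPochhammer_natDegree]
      omega)
    simp only [eval_mul, eval_sub, eval_X, eval_C, sub_self, zero_mul,
      descPochhammer_eval_eq_descFactorial, Nat.descFactorial_eq_factorial_mul_choose] at h1
    have h2 : (m.factorial : ℝ) * ∑ i ∈ range (p + 1), f i * (i - y) * (i.choose m : ℝ) = 0 := by
      rw [← h1, mul_sum]
      refine sum_congr rfl fun i _ => ?_
      push_cast
      ring
    exact (mul_eq_zero.mp h2).resolve_left (by positivity)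
  have hz : ∀ i ∈ range (p + 1),
      z ^ i = ∑ m ∈ range (p + 1), ((i.choose m : ℝ) : ℂ) * (z - 1) ^ m := by
    intro i hi
    have hip : i + 1 ≤ p + 1 := by simpa using hi
    conv_lhs => rw [← sub_add_cancel z 1, add_pow]
    rw [← sum_subset (range_subset_range.mpr hip)]
    · refine sum_congr rfl fun m _ => ?_
      push_cast
      ring
    · intro m _ hm
      rw [Nat.choose_eq_zero_of_lt (by simpa using hm)]
      simp
  calc ∑ i ∈ range (p + 1), ((f i * (i - y) : ℝ) : ℂ) * z ^ i
      = ∑ m ∈ range (p + 1),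
          ((∑ i ∈ range (p + 1), f i * (i - y) * (i.choose m : ℝ) : ℝ) : ℂ) * (z - 1) ^ m := by
        rw [sum_congr rfl fun i hi => by rw [hz i hi, mul_sum], sum_comm]
        refine sum_congr rfl fun m _ => ?_
        rw [Complex.ofReal_sum, sum_mul]
        refine sum_congr rfl fun i _ => ?_
        push_cast
        ring
    _ = _ := by
        rw [sum_range_succ, sum_eq_zero, zero_add, sum_range_succ, sum_eq_zero, zero_add]
        · simp
        · intro i hi
          rw [Nat.choose_eq_zero_of_lt (by simpa using hi)]
          simp
        · intro m hm
          rw [hmom m (by simpa using hm)]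
          simp

theorem Reproduces.last_weight {p : ℕ} {f : ℕ → ℝ} {y : ℝ} (h : Reproduces p f y) :
    f p * (p - y) = -(∏ j ∈ range (p + 1), (y - j)) / p.factorial := by
  have h1 := h (descPochhammer ℝ p) (by rw [descPochhammer_natDegree])
  rw [sum_range_succ, sum_eq_zero, zero_add, descPochhammer_eval_eq_descFactorial,
    Nat.descFactorial_self, descPochhammer_eval_eq_prod_range] at h1
  · rw [prod_range_succ, ← h1]
    field_simp
    ring
  · intro i hi
    rw [descPochhammer_eval_eq_descFactorial, Nat.descFactorial_of_lt (by simpa using hi)]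
    simp

theorem prod_even (q : ℕ) (t : ℝ) :
    ∏ j ∈ range (2 * q + 1), (q + t - j)
      = (-1) ^ q * t * ∏ i ∈ range q, (((i : ℝ) + 1) ^ 2 - t ^ 2) := by
  induction q with
  | zero => simp
  | succ q ih =>
    rw [show 2 * (q + 1) + 1 = (2 * q + 1) + 1 + 1 by ring, prod_range_succ, prod_range_succ',
      prod_congr rfl (g := fun j : ℕ => (q + t - j : ℝ)) (fun j _ => by push_cast; ring), ih,
      prod_range_succ]
    push_cast
    ring

theorem prod_odd (q : ℕ) (t : ℝ) :
    ∏ j ∈ range (2 * q + 2), (q + 1 / 2 + t - j)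
      = (-1) ^ (q + 1) * ∏ i ∈ range (q + 1), (((i : ℝ) + 1 / 2) ^ 2 - t ^ 2) := by
  induction q with
  | zero => simp [prod_range_succ]; ring
  | succ q ih =>
    rw [show 2 * (q + 1) + 2 = (2 * q + 2) + 1 + 1 by ring, prod_range_succ, prod_range_succ',
      prod_congr rfl (g := fun j : ℕ => (q + 1 / 2 + t - j : ℝ)) (fun j _ => by push_cast; ring),
      ih, prod_range_succ _ (q + 1)]
    push_cast
    ring


theorem Reproduces.sum_defect_exp {p : ℕ} {f : ℕ → ℝ} {y : ℝ} (h : Reproduces p f y) (θ : ℝ) :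
    ∑ i ∈ range (p + 1),
        ((f i * (i - y) : ℝ) : ℂ) * Complex.exp ((((i : ℝ) - p / 2) * θ : ℝ) * Complex.I)
      = ((f p * (p - y) * (2 * Real.sin (θ / 2)) ^ p : ℝ) : ℂ) * Complex.I ^ p := by
  have hz := h.sum_defect (Complex.exp (θ * Complex.I))
  have hfac : Complex.exp (-(θ / 2) * Complex.I) * (Complex.exp (θ * Complex.I) - 1)
      = ((2 * Real.sin (θ / 2) : ℝ) : ℂ) * Complex.I := by
    rw [mul_sub, ← Complex.exp_add]
    push_cast
    rw [Complex.sin, show -((θ : ℂ) / 2) * Complex.I + θ * Complex.I = θ / 2 * Complex.I by ring]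
    linear_combination (Complex.exp (θ / 2 * Complex.I) - Complex.exp (-(θ / 2) * Complex.I))
      * Complex.I_sq
  calc _ = Complex.exp (-(θ / 2) * Complex.I) ^ p * ∑ i ∈ range (p + 1),
        ((f i * (i - y) : ℝ) : ℂ) * Complex.exp (θ * Complex.I) ^ i := by
        rw [mul_sum]
        refine sum_congr rfl fun i _ => ?_
        rw [mul_left_comm, ← Complex.exp_nat_mul, ← Complex.exp_nat_mul, ← Complex.exp_add]
        push_cast
        ring_nf
    _ = ((f p * (p - y) : ℝ) : ℂ)
        * (Complex.exp (-(θ / 2) * Complex.I) * (Complex.exp (θ * Complex.I) - 1)) ^ p := by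
        rw [hz, mul_pow]
        ring
    _ = _ := by
        rw [hfac, mul_pow]
        push_cast
        ring

theorem Reproduces.sum_defect_cos {p : ℕ} {f : ℕ → ℝ} {y : ℝ} (h : Reproduces p f y) (θ : ℝ) :
    ∑ i ∈ range (p + 1), f i * (i - y) * Real.cos ((i - p / 2) * θ)
      = f p * (p - y) * (2 * Real.sin (θ / 2)) ^ p * (Complex.I ^ p).re := by
  have := congrArg Complex.re (h.sum_defect_exp θ)
  rw [Complex.re_sum, Complex.re_ofReal_mul] at this
  rw [← this]
  refine sum_congr rfl fun i _ => ?_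
  rw [Complex.re_ofReal_mul, Complex.exp_ofReal_mul_I_re]

theorem Reproduces.sum_defect_sin {p : ℕ} {f : ℕ → ℝ} {y : ℝ} (h : Reproduces p f y) (θ : ℝ) :
    ∑ i ∈ range (p + 1), f i * (i - y) * Real.sin ((i - p / 2) * θ)
      = f p * (p - y) * (2 * Real.sin (θ / 2)) ^ p * (Complex.I ^ p).im := by
  have := congrArg Complex.im (h.sum_defect_exp θ)
  rw [Complex.im_sum, Complex.im_ofReal_mul] at this
  rw [← this]
  refine sum_congr rfl fun i _ => ?_
  rw [Complex.im_ofReal_mul, Complex.exp_ofReal_mul_I_im]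

/-- Real part of the symbol of the weights `f`, centred at `p / 2`. -/
noncomputable def cosSum (p : ℕ) (f : ℕ → ℝ) (θ : ℝ) : ℝ :=
  ∑ i ∈ range (p + 1), f i * Real.cos ((i - p / 2) * θ)

/-- Imaginary part of the symbol of the weights `f`, centred at `p / 2`. -/
noncomputable def sinSum (p : ℕ) (f : ℕ → ℝ) (θ : ℝ) : ℝ :=
  ∑ i ∈ range (p + 1), f i * Real.sin ((i - p / 2) * θ)

theorem Reproduces.hasDerivAt_cosSum {p : ℕ} {f : ℕ → ℝ} {y : ℝ} (h : Reproduces p f y) (θ : ℝ) :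
    HasDerivAt (cosSum p f) (-(y - p / 2) * sinSum p f θ
      - f p * (p - y) * (2 * Real.sin (θ / 2)) ^ p * (Complex.I ^ p).im) θ := by
  have hd : HasDerivAt (cosSum p f)
      (∑ i ∈ range (p + 1), f i * (-Real.sin ((i - p / 2) * θ) * ((i - p / 2) * 1))) θ :=
    HasDerivAt.fun_sum fun i _ => ((hasDerivAt_id θ).const_mul ((i : ℝ) - p / 2)).cos.const_mul (f i)
  convert hd using 1
  rw [← h.sum_defect_sin, sinSum, mul_sum, ← sum_sub_distrib]
  exact sum_congr rfl fun i _ => by ring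

theorem Reproduces.hasDerivAt_sinSum {p : ℕ} {f : ℕ → ℝ} {y : ℝ} (h : Reproduces p f y) (θ : ℝ) :
    HasDerivAt (sinSum p f) ((y - p / 2) * cosSum p f θ
      + f p * (p - y) * (2 * Real.sin (θ / 2)) ^ p * (Complex.I ^ p).re) θ := by
  have hd : HasDerivAt (sinSum p f)
      (∑ i ∈ range (p + 1), f i * (Real.cos ((i - p / 2) * θ) * ((i - p / 2) * 1))) θ :=
    HasDerivAt.fun_sum fun i _ => ((hasDerivAt_id θ).const_mul ((i : ℝ) - p / 2)).sin.const_mul (f i)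
  convert hd using 1
  rw [← h.sum_defect_cos, cosSum, mul_sum, ← sum_add_distrib]
  exact sum_congr rfl fun i _ => by ring

theorem Reproduces.cosSum_zero {p : ℕ} {f : ℕ → ℝ} {y : ℝ} (h : Reproduces p f y) :
    cosSum p f 0 = 1 := by
  simpa [cosSum] using h 1 (by simp)

theorem sinSum_zero (p : ℕ) (f : ℕ → ℝ) : sinSum p f 0 = 0 := by
  simp [sinSum]

theorem antitoneOn_Icc_of_hasDerivAt {g g' : ℝ → ℝ} {a b : ℝ}
    (hg : ∀ x ∈ Set.Icc a b, HasDerivAt g (g' x) x) (hg' : ∀ x ∈ Set.Ioo a b, g' x ≤ 0) :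
    AntitoneOn g (Set.Icc a b) := by
  refine antitoneOn_of_hasDerivWithinAt_nonpos (f' := g') (convex_Icc a b)
    (fun x hx => (hg x hx).continuousAt.continuousWithinAt) ?_ ?_
  · intro x hx
    exact (hg x (interior_subset hx)).hasDerivWithinAt
  · rwa [interior_Icc]

theorem hasDerivAt_two_sin_half_pow (p : ℕ) (θ : ℝ) :
    HasDerivAt (fun θ => (2 * Real.sin (θ / 2)) ^ p)
      (p * (2 * Real.sin (θ / 2)) ^ (p - 1) * Real.cos (θ / 2)) θ := by
  have h := (((hasDerivAt_id θ).div_const 2).sin.const_mul 2).pow p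
  refine h.congr_deriv ?_
  simp only [id]
  ring

theorem sin_half_nonneg {θ : ℝ} (h0 : 0 ≤ θ) (hπ : θ ≤ Real.pi) : 0 ≤ Real.sin (θ / 2) :=
  Real.sin_nonneg_of_nonneg_of_le_pi (by linarith) (by linarith)

theorem deriv_two_sin_half_pow_nonneg (p : ℕ) {θ : ℝ} (h0 : 0 ≤ θ) (hπ : θ ≤ Real.pi) :
    0 ≤ p * (2 * Real.sin (θ / 2)) ^ (p - 1) * Real.cos (θ / 2) := by
  have := sin_half_nonneg h0 hπ
  have : 0 ≤ Real.cos (θ / 2) := Real.cos_nonneg_of_mem_Icc ⟨by linarith, by linarith⟩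
  positivity

theorem mul_sin_mul_nonneg {t θ : ℝ} (ht : |t| ≤ 1) (h0 : 0 ≤ θ) (hπ : θ ≤ Real.pi) :
    0 ≤ t * Real.sin (t * θ) := by
  obtain ⟨h1, h2⟩ := abs_le.mp ht
  rcases le_total 0 t with h | h
  · exact mul_nonneg h (Real.sin_nonneg_of_nonneg_of_le_pi (by positivity) (by nlinarith))
  · exact mul_nonneg_of_nonpos_of_nonpos h
      (Real.sin_nonpos_of_nonpos_of_neg_pi_le (by nlinarith) (by nlinarith))

theorem sinSum_pi_even (q : ℕ) (f : ℕ → ℝ) : sinSum (2 * q) f Real.pi = 0 := by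
  refine sum_eq_zero fun i _ => ?_
  have : ((i : ℝ) - (2 * q : ℕ) / 2) = ((i - q : ℤ) : ℝ) := by push_cast; ring
  rw [this, Real.sin_int_mul_pi, mul_zero]

theorem cosSum_pi_odd (q : ℕ) (f : ℕ → ℝ) : cosSum (2 * q + 1) f Real.pi = 0 := by
  refine sum_eq_zero fun i _ => ?_
  have : ((i : ℝ) - (2 * q + 1 : ℕ) / 2) * Real.pi = ((i - q : ℤ) : ℝ) * Real.pi - Real.pi / 2 := by
    push_cast; ring
  rw [this, Real.cos_sub_pi_div_two, Real.sin_int_mul_pi, mul_zero]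

/-- Sturm comparison with `sin (t θ)`. -/
theorem mul_sin_part_nonneg {u v : ℝ → ℝ} {t κ : ℝ} {p : ℕ} (hκ : 0 ≤ κ) (ht : |t| < 1)
    (hu : ∀ θ, HasDerivAt u (-t * v θ) θ)
    (hv : ∀ θ, HasDerivAt v (t * u θ - t * κ * (2 * Real.sin (θ / 2)) ^ p) θ)
    (hv0 : v 0 = 0) (hvπ : v Real.pi = 0) {θ : ℝ} (h0 : 0 < θ) (hπ : θ < Real.pi) :
    0 ≤ t * v θ := by
  rcases eq_or_ne t 0 with rfl | ht0
  · simp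
  have hlin : ∀ θ : ℝ, HasDerivAt (fun θ => t * θ) t θ := fun θ => by
    simpa using (hasDerivAt_id θ).const_mul t
  set w : ℝ → ℝ := fun θ => t * ((u θ - κ * (2 * Real.sin (θ / 2)) ^ p) * Real.sin (t * θ)
    - v θ * Real.cos (t * θ)) with hw
  have hw' : ∀ θ, HasDerivAt w (-κ * (p * (2 * Real.sin (θ / 2)) ^ (p - 1) * Real.cos (θ / 2))
      * (t * Real.sin (t * θ))) θ := by
    intro θ
    have := ((((hu θ).sub ((hasDerivAt_two_sin_half_pow p θ).const_mul κ)).mul (hlin θ).sin).sub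
      ((hv θ).mul (hlin θ).cos)).const_mul t
    refine this.congr_deriv ?_
    simp only [Pi.sub_apply]
    ring
  have hwneg : ∀ θ ∈ Set.Icc 0 Real.pi, w θ ≤ 0 := by
    intro θ hθ
    have hanti := antitoneOn_Icc_of_hasDerivAt (a := 0) (b := Real.pi) (fun θ _ => hw' θ)
      (fun θ hθ => by
        have h1 := deriv_two_sin_half_pow_nonneg p hθ.1.le hθ.2.le
        have h2 := mul_sin_mul_nonneg ht.le hθ.1.le hθ.2.le
        have := mul_nonneg (mul_nonneg hκ h1) h2
        linarith)
    have := hanti (Set.left_mem_Icc.mpr Real.pi_pos.le) hθ hθ.1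
    simpa [hw, hv0] using this
  have hsin : ∀ x ∈ Set.Icc θ Real.pi, Real.sin (t * x) ≠ 0 := by
    intro x hx
    have hx0 : 0 < x := h0.trans_le hx.1
    obtain ⟨h1, h2⟩ := abs_lt.mp ht
    rcases lt_or_gt_of_ne ht0 with h | h
    · exact (Real.sin_neg_of_neg_of_neg_pi_lt (by nlinarith) (by nlinarith [hx.2])).ne
    · exact (Real.sin_pos_of_pos_of_lt_pi (by positivity) (by nlinarith [hx.2])).ne'
  have hanti := antitoneOn_Icc_of_hasDerivAt (a := θ) (b := Real.pi)
    (g := fun x => v x / Real.sin (t * x)) (g' := fun x => w x / Real.sin (t * x) ^ 2)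
    (fun x hx => ((hv x).div (hlin x).sin (hsin x hx)).congr_deriv (by simp only [hw]; ring))
    (fun x hx => div_nonpos_of_nonpos_of_nonneg (hwneg x ⟨(h0.trans hx.1).le, hx.2.le⟩)
      (sq_nonneg _))
  have hr := hanti (Set.left_mem_Icc.mpr hπ.le) (Set.right_mem_Icc.mpr hπ.le) hπ.le
  simp only [hvπ, zero_div] at hr
  have hθ := hsin θ (Set.left_mem_Icc.mpr hπ.le)
  have := mul_nonneg hr (mul_sin_mul_nonneg ht.le h0.le hπ.le)
  rwa [show v θ / Real.sin (t * θ) * (t * Real.sin (t * θ)) = t * v θ by field_simp] at this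

/-- Sturm comparison with `cos (t θ)`. -/
theorem cos_part_nonneg {u v : ℝ → ℝ} {t κ : ℝ} {p : ℕ} (hp : p ≠ 0) (hκ : 0 ≤ κ)
    (ht : |t| < 1 / 2)
    (hu : ∀ θ, HasDerivAt u (-t * v θ - κ * (2 * Real.sin (θ / 2)) ^ p) θ)
    (hv : ∀ θ, HasDerivAt v (t * u θ) θ)
    (hv0 : v 0 = 0) (huπ : u Real.pi = 0) {θ : ℝ} (h0 : 0 < θ) (hπ : θ < Real.pi) :
    0 ≤ u θ := by
  have hlin : ∀ θ : ℝ, HasDerivAt (fun θ => t * θ) t θ := fun θ => by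
    simpa using (hasDerivAt_id θ).const_mul t
  have hcos : ∀ x ∈ Set.Icc 0 Real.pi, 0 < Real.cos (t * x) := by
    intro x hx
    obtain ⟨h1, h2⟩ := abs_lt.mp ht
    exact Real.cos_pos_of_mem_Ioo ⟨by nlinarith [hx.1, hx.2, Real.pi_pos],
      by nlinarith [hx.1, hx.2, Real.pi_pos]⟩
  set w : ℝ → ℝ := fun θ => (-t * v θ - κ * (2 * Real.sin (θ / 2)) ^ p) * Real.cos (t * θ)
    + t * u θ * Real.sin (t * θ) with hw
  have hw' : ∀ θ, HasDerivAt w (-κ * (p * (2 * Real.sin (θ / 2)) ^ (p - 1) * Real.cos (θ / 2))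
      * Real.cos (t * θ)) θ := by
    intro θ
    have := ((((hv θ).const_mul (-t)).sub ((hasDerivAt_two_sin_half_pow p θ).const_mul κ)).mul
      (hlin θ).cos).add (((hu θ).const_mul t).mul (hlin θ).sin)
    refine this.congr_deriv ?_
    simp only [Pi.sub_apply]
    ring
  have hwneg : ∀ θ ∈ Set.Icc 0 Real.pi, w θ ≤ 0 := by
    intro θ hθ
    have hanti := antitoneOn_Icc_of_hasDerivAt (a := 0) (b := Real.pi) (fun θ _ => hw' θ)
      (fun θ hθ => by
        have h1 := deriv_two_sin_half_pow_nonneg p hθ.1.le hθ.2.le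
        have h2 := (hcos θ ⟨hθ.1.le, hθ.2.le⟩).le
        have := mul_nonneg (mul_nonneg hκ h1) h2
        linarith)
    have := hanti (Set.left_mem_Icc.mpr Real.pi_pos.le) hθ hθ.1
    simpa [hw, hv0, hp] using this
  have hsub : ∀ x ∈ Set.Icc θ Real.pi, x ∈ Set.Icc 0 Real.pi := fun x hx =>
    ⟨h0.le.trans hx.1, hx.2⟩
  have hanti := antitoneOn_Icc_of_hasDerivAt (a := θ) (b := Real.pi)
    (g := fun x => u x / Real.cos (t * x)) (g' := fun x => w x / Real.cos (t * x) ^ 2)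
    (fun x hx => ((hu x).div (hlin x).cos (hcos x (hsub x hx)).ne').congr_deriv
      (by simp only [hw]; ring))
    (fun x hx => div_nonpos_of_nonpos_of_nonneg (hwneg x (hsub x ⟨hx.1.le, hx.2.le⟩))
      (sq_nonneg _))
  have hr := hanti (Set.left_mem_Icc.mpr hπ.le) (Set.right_mem_Icc.mpr hπ.le) hπ.le
  simp only [huπ, zero_div] at hr
  have hθ := hcos θ ⟨h0.le, hπ.le⟩
  have := mul_nonneg hr hθ.le
  rwa [div_mul_cancel₀ _ hθ.ne'] at this

theorem sq_add_sq_le_one {u v u' v' : ℝ → ℝ}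
    (hu : ∀ θ, HasDerivAt u (u' θ) θ) (hv : ∀ θ, HasDerivAt v (v' θ) θ)
    (hu0 : u 0 = 1) (hv0 : v 0 = 0)
    (hg : ∀ θ, 0 < θ → θ < Real.pi → u θ * u' θ + v θ * v' θ ≤ 0)
    {θ : ℝ} (h0 : 0 ≤ θ) (hπ : θ ≤ Real.pi) : u θ ^ 2 + v θ ^ 2 ≤ 1 := by
  have hanti := antitoneOn_Icc_of_hasDerivAt (a := 0) (b := Real.pi)
    (g := fun θ => u θ ^ 2 + v θ ^ 2) (g' := fun θ => 2 * (u θ * u' θ + v θ * v' θ))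
    (fun x _ => (((hu x).pow 2).add ((hv x).pow 2)).congr_deriv (by norm_num; ring))
    (fun x hx => by have := hg x hx.1 hx.2; linarith)
  simpa [hu0, hv0] using hanti (Set.left_mem_Icc.mpr Real.pi_pos.le) ⟨h0, hπ⟩ h0

theorem Reproduces.symbol_le_one_even {q : ℕ} {f : ℕ → ℝ} {t : ℝ} (hq : q ≠ 0)
    (h : Reproduces (2 * q) f (q + t)) (ht : |t| ≤ 1) {θ : ℝ} (h0 : 0 ≤ θ) (hπ : θ ≤ Real.pi) :
    cosSum (2 * q) f θ ^ 2 + sinSum (2 * q) f θ ^ 2 ≤ 1 := by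
  set κ : ℝ := (∏ i ∈ range q, (((i : ℝ) + 1) ^ 2 - t ^ 2)) / (2 * q).factorial with hκdef
  have ht2 : t ^ 2 ≤ 1 := (sq_le_one_iff_abs_le_one t).mpr ht
  have hκ : 0 ≤ κ := div_nonneg (prod_nonneg fun i _ => by
    have : (0 : ℝ) ≤ i := by positivity
    nlinarith) (by positivity)
  have hK : f (2 * q) * ((2 * q : ℕ) - (q + t)) * (-1) ^ q = -(t * κ) := by
    rw [h.last_weight, prod_even, hκdef]
    have : ((-1 : ℝ) ^ q) * (-1) ^ q = 1 := by rw [← mul_pow]; norm_num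
    linear_combination (-(t * (∏ i ∈ range q, (((i : ℝ) + 1) ^ 2 - t ^ 2))
      / (2 * q).factorial)) * this
  have hI : Complex.I ^ (2 * q) = (((-1) ^ q : ℝ) : ℂ) := by
    rw [pow_mul, Complex.I_sq]; push_cast; rfl
  have hu : ∀ θ, HasDerivAt (cosSum (2 * q) f) (-t * sinSum (2 * q) f θ) θ := fun θ =>
    (h.hasDerivAt_cosSum θ).congr_deriv (by
      rw [hI, Complex.ofReal_im]; push_cast; ring)
  have hv : ∀ θ, HasDerivAt (sinSum (2 * q) f)
      (t * cosSum (2 * q) f θ - t * κ * (2 * Real.sin (θ / 2)) ^ (2 * q)) θ := fun θ =>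
    (h.hasDerivAt_sinSum θ).congr_deriv (by
      rw [hI, Complex.ofReal_re]
      push_cast at hK ⊢
      linear_combination (2 * Real.sin (θ / 2)) ^ (2 * q) * hK)
  refine sq_add_sq_le_one hu hv h.cosSum_zero (sinSum_zero _ _) (fun x hx0 hxπ => ?_) h0 hπ
  have hsin := sin_half_nonneg hx0.le hxπ.le
  have key : 0 ≤ κ * (t * sinSum (2 * q) f x) := by
    rcases ht.lt_or_eq with hlt | heq
    · exact mul_nonneg hκ (mul_sin_part_nonneg hκ hlt hu hv (sinSum_zero _ _)
        (sinSum_pi_even q f) hx0 hxπ)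
    · have : κ = 0 := by
        rw [hκdef, prod_eq_zero (mem_range.mpr (Nat.pos_of_ne_zero hq)), zero_div]
        rw [← sq_abs t, heq]
        norm_num
      simp [this]
  have := mul_nonneg key (pow_nonneg (mul_nonneg zero_le_two hsin) (2 * q))
  linarith

theorem Reproduces.symbol_le_one_odd {q : ℕ} {f : ℕ → ℝ} {t : ℝ}
    (h : Reproduces (2 * q + 1) f (q + 1 / 2 + t)) (ht : |t| ≤ 1 / 2) {θ : ℝ}
    (h0 : 0 ≤ θ) (hπ : θ ≤ Real.pi) :
    cosSum (2 * q + 1) f θ ^ 2 + sinSum (2 * q + 1) f θ ^ 2 ≤ 1 := by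
  set κ : ℝ := (∏ i ∈ range (q + 1), (((i : ℝ) + 1 / 2) ^ 2 - t ^ 2)) / (2 * q + 1).factorial
    with hκdef
  have ht2 : t ^ 2 ≤ (1 / 2) ^ 2 := by rw [← sq_abs t]; gcongr
  have hκ : 0 ≤ κ := div_nonneg (prod_nonneg fun i _ => by
    have : (0 : ℝ) ≤ i := by positivity
    nlinarith) (by positivity)
  have hK : f (2 * q + 1) * ((2 * q + 1 : ℕ) - (q + 1 / 2 + t)) * (-1) ^ q = κ := by
    rw [h.last_weight, prod_odd, hκdef]
    have : ((-1 : ℝ) ^ q) * (-1) ^ q = 1 := by rw [← mul_pow]; norm_num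
    linear_combination ((∏ i ∈ range (q + 1), (((i : ℝ) + 1 / 2) ^ 2 - t ^ 2))
      / (2 * q + 1).factorial) * this
  have hI : Complex.I ^ (2 * q + 1) = (((-1) ^ q : ℝ) : ℂ) * Complex.I := by
    rw [pow_succ, pow_mul, Complex.I_sq]; push_cast; rfl
  have hu : ∀ θ, HasDerivAt (cosSum (2 * q + 1) f)
      (-t * sinSum (2 * q + 1) f θ - κ * (2 * Real.sin (θ / 2)) ^ (2 * q + 1)) θ := fun θ =>
    (h.hasDerivAt_cosSum θ).congr_deriv (by
      rw [hI, Complex.im_ofReal_mul, Complex.I_im]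
      push_cast at hK ⊢
      linear_combination (-(2 * Real.sin (θ / 2)) ^ (2 * q + 1)) * hK)
  have hv : ∀ θ, HasDerivAt (sinSum (2 * q + 1) f) (t * cosSum (2 * q + 1) f θ) θ := fun θ =>
    (h.hasDerivAt_sinSum θ).congr_deriv (by
      rw [hI, Complex.re_ofReal_mul, Complex.I_re]; push_cast; ring)
  refine sq_add_sq_le_one hu hv h.cosSum_zero (sinSum_zero _ _) (fun x hx0 hxπ => ?_) h0 hπ
  have hsin := sin_half_nonneg hx0.le hxπ.le
  have key : 0 ≤ κ * cosSum (2 * q + 1) f x := by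
    rcases ht.lt_or_eq with hlt | heq
    · exact mul_nonneg hκ (cos_part_nonneg (by omega) hκ hlt hu hv (sinSum_zero _ _)
        (cosSum_pi_odd q f) hx0 hxπ)
    · have : κ = 0 := by
        rw [hκdef, prod_eq_zero (mem_range.mpr (Nat.succ_pos q)), zero_div]
        rw [← sq_abs t, heq]
        norm_num
      simp [this]
  have := mul_nonneg key (pow_nonneg (mul_nonneg zero_le_two hsin) (2 * q + 1))
  linarith

theorem normSq_symbol (p : ℕ) (f : ℕ → ℝ) (a : ℤ) (θ : ℝ) :
    Complex.normSq (∑ i ∈ range (p + 1),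
        (f i : ℂ) * Complex.exp ((((a + i : ℤ) : ℝ) * θ : ℝ) * Complex.I))
      = cosSum p f θ ^ 2 + sinSum p f θ ^ 2 := by
  have h1 : ∑ i ∈ range (p + 1),
        (f i : ℂ) * Complex.exp ((((a + i : ℤ) : ℝ) * θ : ℝ) * Complex.I)
      = Complex.exp (((a + p / 2) * θ : ℝ) * Complex.I) *
        ∑ i ∈ range (p + 1), (f i : ℂ) * Complex.exp ((((i : ℝ) - p / 2) * θ : ℝ) * Complex.I) := by
    rw [mul_sum]
    refine sum_congr rfl fun i _ => ?_
    rw [mul_left_comm, ← Complex.exp_add]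
    push_cast
    ring_nf
  rw [h1, map_mul, Complex.normSq_eq_norm_sq, Complex.norm_exp_ofReal_mul_I, one_pow, one_mul,
    Complex.normSq_apply, ← sq, ← sq, Complex.re_sum, Complex.im_sum, cosSum, sinSum]
  simp_rw [Complex.re_ofReal_mul, Complex.im_ofReal_mul, Complex.exp_ofReal_mul_I_re,
    Complex.exp_ofReal_mul_I_im]

theorem integral_cos_int_mul (n : ℤ) :
    ∫ θ in (0 : ℝ)..Real.pi, Real.cos (n * θ) = if n = 0 then Real.pi else 0 := by
  split_ifs with h
  · simp [h]
  · rw [intervalIntegral.integral_comp_mul_left (fun x => Real.cos x) (by exact_mod_cast h)]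
    simp [Real.sin_int_mul_pi]

/-- Parseval's identity for real trigonometric polynomials, on half a period. -/
theorem integral_normSq_trig_sum (s : Finset ℤ) (c : ℤ → ℝ) :
    ∫ θ in (0 : ℝ)..Real.pi,
        Complex.normSq (∑ j ∈ s, (c j : ℂ) * Complex.exp ((-(j * θ) : ℝ) * Complex.I))
      = Real.pi * ∑ j ∈ s, c j ^ 2 := by
  have hpt : ∀ θ : ℝ,
      Complex.normSq (∑ j ∈ s, (c j : ℂ) * Complex.exp ((-(j * θ) : ℝ) * Complex.I))
        = ∑ j ∈ s, ∑ l ∈ s, c j * c l * Real.cos ((j - l : ℤ) * θ) := by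
    intro θ
    rw [Complex.normSq_apply, Complex.re_sum, Complex.im_sum, sum_mul_sum, sum_mul_sum,
      ← sum_add_distrib]
    refine sum_congr rfl fun j _ => ?_
    rw [← sum_add_distrib]
    refine sum_congr rfl fun l _ => ?_
    simp_rw [Complex.re_ofReal_mul, Complex.im_ofReal_mul, Complex.exp_ofReal_mul_I_re,
      Complex.exp_ofReal_mul_I_im, Real.cos_neg, Real.sin_neg]
    rw [show ((j - l : ℤ) : ℝ) * θ = j * θ - l * θ by push_cast; ring, Real.cos_sub]
    ring
  simp_rw [hpt]
  rw [intervalIntegral.integral_finsetSum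
    (fun j _ => (by fun_prop : Continuous _).intervalIntegrable _ _), mul_sum]
  refine sum_congr rfl fun j hj => ?_
  rw [intervalIntegral.integral_finsetSum
    (fun j _ => (by fun_prop : Continuous _).intervalIntegrable _ _)]
  simp_rw [intervalIntegral.integral_const_mul, integral_cos_int_mul, sub_eq_zero]
  simp only [mul_ite, mul_zero, sum_ite_eq, hj, if_true]
  ring

theorem sum_sq_conv_le_of_support {p : ℕ} {f : ℕ → ℝ} (a : ℤ)
    (hf : ∀ θ, 0 ≤ θ → θ ≤ Real.pi → cosSum p f θ ^ 2 + sinSum p f θ ^ 2 ≤ 1)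
    {c : ℤ → ℝ} {s : Finset ℤ} (hc : ∀ j ∉ s, c j = 0) (F : Finset ℤ) :
    ∑ j ∈ F, (∑ i ∈ range (p + 1), f i * c (j + (a + i))) ^ 2 ≤ ∑ j ∈ s, c j ^ 2 := by
  set T : Finset ℤ := F ∪ s.biUnion fun l => (range (p + 1)).image fun i : ℕ => l - (a + (i : ℤ))
    with hT
  set d : ℤ → ℝ := fun j => ∑ i ∈ range (p + 1), f i * c (j + (a + i)) with hd
  have hshift : ∀ i ∈ range (p + 1), ∀ g : ℤ → ℂ,
      ∑ j ∈ T, (c (j + (a + i)) : ℂ) * g (j + (a + i)) = ∑ l ∈ s, (c l : ℂ) * g l := by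
    intro i hi g
    rw [← sum_image (f := fun l => (c l : ℂ) * g l) (g := fun j : ℤ => j + (a + (i : ℤ)))
      (fun x _ y _ h => by simpa using h)]
    symm
    refine sum_subset (fun l hl => ?_) (fun l _ hl => by simp [hc l hl])
    refine mem_image.mpr ⟨l - (a + i), ?_, by ring⟩
    exact mem_union_right _ (mem_biUnion.mpr ⟨l, hl, mem_image.mpr ⟨i, hi, rfl⟩⟩)
  have hprod : ∀ θ : ℝ, ∑ j ∈ T, (d j : ℂ) * Complex.exp ((-(j * θ) : ℝ) * Complex.I)
      = (∑ i ∈ range (p + 1),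
          (f i : ℂ) * Complex.exp ((((a + i : ℤ) : ℝ) * θ : ℝ) * Complex.I))
        * ∑ l ∈ s, (c l : ℂ) * Complex.exp ((-(l * θ) : ℝ) * Complex.I) := by
    intro θ
    rw [sum_mul]
    simp only [hd, Complex.ofReal_sum, sum_mul]
    rw [sum_comm]
    refine sum_congr rfl fun i hi => ?_
    rw [← hshift i hi (fun l => Complex.exp ((-(l * θ) : ℝ) * Complex.I)), mul_sum]
    refine sum_congr rfl fun j _ => ?_
    rw [mul_mul_mul_comm, ← Complex.exp_add]
    push_cast
    ring_nf
  have hle : Real.pi * ∑ j ∈ T, d j ^ 2 ≤ Real.pi * ∑ l ∈ s, c l ^ 2 := by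
    rw [← integral_normSq_trig_sum, ← integral_normSq_trig_sum]
    have hcont : ∀ (s : Finset ℤ) (c : ℤ → ℝ), Continuous fun θ : ℝ =>
        Complex.normSq (∑ j ∈ s, (c j : ℂ) * Complex.exp ((-(j * θ) : ℝ) * Complex.I)) :=
      fun s c => Complex.continuous_normSq.comp (by fun_prop)
    refine intervalIntegral.integral_mono_on Real.pi_pos.le
      ((hcont _ _).intervalIntegrable _ _) ((hcont _ _).intervalIntegrable _ _) fun θ hθ => ?_
    rw [hprod, map_mul, normSq_symbol]
    exact mul_le_of_le_one_left (Complex.normSq_nonneg _) (hf θ hθ.1 hθ.2)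
  exact (sum_le_sum_of_subset_of_nonneg subset_union_left fun _ _ _ => sq_nonneg _).trans
    (le_of_mul_le_mul_left hle Real.pi_pos)

theorem tsum_sq_conv_le {p : ℕ} {f : ℕ → ℝ} (a : ℤ)
    (hf : ∀ θ, 0 ≤ θ → θ ≤ Real.pi → cosSum p f θ ^ 2 + sinSum p f θ ^ 2 ≤ 1)
    {c : ℤ → ℝ} (hc : Summable fun j => c j ^ 2) :
    ∑' j : ℤ, (∑ i ∈ range (p + 1), f i * c (j + (a + i))) ^ 2 ≤ ∑' j : ℤ, c j ^ 2 := by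
  have hfin : ∀ F : Finset ℤ,
      ∑ j ∈ F, (∑ i ∈ range (p + 1), f i * c (j + (a + i))) ^ 2 ≤ ∑' j : ℤ, c j ^ 2 := by
    intro F
    set s : Finset ℤ := F.biUnion fun j => (range (p + 1)).image fun i : ℕ => j + (a + (i : ℤ)) with hs
    have h := sum_sq_conv_le_of_support a hf (c := fun l => if l ∈ s then c l else 0) (s := s)
      (fun j hj => if_neg hj) F
    have h1 : ∀ j ∈ F, ∑ i ∈ range (p + 1), f i * (if j + (a + i) ∈ s then c (j + (a + i)) else 0)
        = ∑ i ∈ range (p + 1), f i * c (j + (a + i)) := fun j hj =>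
      sum_congr rfl fun i hi => by
        rw [if_pos (mem_biUnion.mpr ⟨j, hj, mem_image.mpr ⟨i, hi, rfl⟩⟩)]
    rw [sum_congr rfl fun j hj => by rw [h1 j hj],
      sum_congr (s₁ := s) rfl fun l hl => by rw [if_pos hl]] at h
    exact h.trans (hc.sum_le_tsum s fun _ _ => sq_nonneg _)
  exact (summable_of_sum_le (fun _ => sq_nonneg _) hfin).tsum_le_of_sum_le hfin

/-- Testing an `ℓ²` contraction on long alternating sequences bounds its symbol at `π`. -/
theorem abs_alternating_sum_le_one {p : ℕ} {f : ℕ → ℝ} (a : ℤ)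
    (h : ∀ c : ℤ → ℝ, (Summable fun j => c j ^ 2) →
      ∑' j : ℤ, (∑ i ∈ range (p + 1), f i * c (j + (a + i))) ^ 2 ≤ ∑' j : ℤ, c j ^ 2) :
    |∑ i ∈ range (p + 1), f i * (-1) ^ i| ≤ 1 := by
  set H := ∑ i ∈ range (p + 1), f i * (-1) ^ i with hH
  have hN : ∀ N : ℕ, H ^ 2 * N ≤ N + p := by
    intro N
    set s : Finset ℤ := (range (N + p)).image fun n : ℕ => (n : ℤ) with hs
    set c : ℤ → ℝ := fun j => if j ∈ s then (-1) ^ j.toNat else 0 with hcdef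
    have hc0 : ∀ j ∉ s, c j = 0 := fun j hj => if_neg hj
    have hcn : ∀ n < N + p, c n = (-1) ^ n := fun n hn => by
      simp [hcdef, hs, hn]
    have hsum : ∑' j : ℤ, c j ^ 2 = N + p := by
      rw [tsum_eq_sum (s := s) (fun j hj => by simp [hc0 j hj]), hs,
        sum_image (fun x _ y _ hxy => by simpa using hxy),
        sum_congr rfl (g := fun _ => (1 : ℝ))]
      · simp
      · intro n hn
        rw [hcn n (by simpa using hn), ← pow_mul, mul_comm, pow_mul]
        simp
    have hle := h c (summable_of_ne_finset_zero (s := s) fun j hj => by simp [hc0 j hj])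
    rw [hsum] at hle
    set U : Finset ℤ := s.biUnion fun l => (range (p + 1)).image fun i : ℕ => l - (a + (i : ℤ)) with hU
    have hsummable : Summable fun j : ℤ => (∑ i ∈ range (p + 1), f i * c (j + (a + i))) ^ 2 := by
      refine summable_of_ne_finset_zero (s := U) fun j hj => ?_
      rw [sum_eq_zero, sq, zero_mul]
      intro i hi
      rw [hc0, mul_zero]
      intro hmem
      exact hj (mem_biUnion.mpr ⟨_, hmem, mem_image.mpr ⟨i, hi, by ring⟩⟩)
    have hpart := hsummable.sum_le_tsum ((range N).image fun n : ℕ => (n : ℤ) - a)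
      fun _ _ => sq_nonneg _
    rw [sum_image (fun x _ y _ hxy => by simpa using hxy),
      sum_congr rfl (g := fun _ => H ^ 2)] at hpart
    · simp only [sum_const, card_range, nsmul_eq_mul] at hpart
      linarith
    · intro n hn
      have hn' : n < N := by simpa using hn
      have : ∑ i ∈ range (p + 1), f i * c ((n : ℤ) - a + (a + i)) = (-1) ^ n * H := by
        rw [hH, mul_sum]
        refine sum_congr rfl fun i hi => ?_
        have hi' : i < p + 1 := by simpa using hi
        rw [show (n : ℤ) - a + (a + i) = ((n + i : ℕ) : ℤ) by push_cast; ring,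
          hcn _ (by omega), pow_add]
        ring
      rw [this, mul_pow, ← pow_mul, mul_comm n, pow_mul]
      simp
  rw [← sq_le_one_iff_abs_le_one]
  by_contra! hlt
  obtain ⟨N, hNlt⟩ := exists_nat_gt (p / (H ^ 2 - 1))
  rw [div_lt_iff₀ (by linarith)] at hNlt
  linarith [hN N]

/-- The polynomial of degree at most `n` taking the value `(-1) ^ i` at the nodes `0, …, n`. -/
noncomputable def altPoly (n : ℕ) : ℝ[X] :=
  ∑ m ∈ range (n + 1), C ((-2) ^ m / (m.factorial : ℝ)) * descPochhammer ℝ m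

theorem natDegree_altPoly_le (n : ℕ) : (altPoly n).natDegree ≤ n := by
  refine natDegree_sum_le_of_forall_le _ _ fun m hm => ?_
  refine (natDegree_C_mul_le _ _).trans ?_
  rw [descPochhammer_natDegree]
  simpa [Nat.lt_succ_iff] using hm

theorem altPoly_eval_nat {n i : ℕ} (hi : i ≤ n) : (altPoly n).eval (i : ℝ) = (-1) ^ i := by
  have h1 : (-1 : ℝ) ^ i = (-2 + 1) ^ i := by norm_num
  rw [h1, add_pow, altPoly, eval_finsetSum,
    ← sum_subset (range_subset_range.mpr (Nat.succ_le_succ hi))]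
  · refine sum_congr rfl fun m _ => ?_
    rw [eval_mul, eval_C, descPochhammer_eval_eq_descFactorial,
      Nat.descFactorial_eq_factorial_mul_choose]
    push_cast
    field_simp
    simp
  · intro m _ hm
    rw [eval_mul, descPochhammer_eval_eq_descFactorial,
      Nat.descFactorial_of_lt (by simpa using hm)]
    simp

theorem altPoly_succ_eval (n : ℕ) (y : ℝ) :
    (altPoly (n + 1)).eval y = (altPoly n).eval y
      + (-2) ^ (n + 1) / ((n + 1).factorial : ℝ) * ∏ j ∈ range (n + 1), (y - j) := by
  rw [altPoly, sum_range_succ, ← altPoly, eval_add, eval_mul, eval_C,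
    descPochhammer_eval_eq_prod_range]

theorem altPoly_eval_sub (n : ℕ) (y : ℝ) :
    (altPoly n).eval (n - y) = (-1) ^ n * (altPoly n).eval y := by
  have h : (altPoly n).comp (C (n : ℝ) - X) = C ((-1) ^ n) * altPoly n := by
    refine eq_of_natDegree_lt_card_of_eval_eq _ _ (f := fun i : Fin (n + 1) => ((i : ℕ) : ℝ))
      (fun i j hij => Fin.ext (by simpa using hij)) (fun i => ?_) ?_
    · have hi : (i : ℕ) ≤ n := Nat.lt_succ_iff.mp i.2
      rw [eval_comp, eval_mul, eval_C, altPoly_eval_nat hi, eval_sub, eval_C, eval_X,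
        ← Nat.cast_sub hi, altPoly_eval_nat (Nat.sub_le _ _)]
      obtain ⟨m, hm⟩ := Nat.exists_eq_add_of_le hi
      have : ((-1 : ℝ) ^ (i : ℕ)) * (-1) ^ (i : ℕ) = 1 := by rw [← mul_pow]; norm_num
      have hni : (-1 : ℝ) ^ n = (-1) ^ (i : ℕ) * (-1) ^ m := by rw [← pow_add, ← hm]
      rw [show n - i = m by omega, hni]
      linear_combination (-(-1) ^ m) * this
    · rw [Fintype.card_fin, Nat.lt_succ_iff, max_le_iff]
      refine ⟨?_, (natDegree_C_mul_le _ _).trans (natDegree_altPoly_le n)⟩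
      rw [natDegree_comp]
      refine (Nat.mul_le_mul (natDegree_altPoly_le n) ?_).trans (mul_one n).le
      exact (natDegree_sub_le _ _).trans (by simp)
  simpa using congrArg (eval y) h

theorem newton_term_nonneg {s n : ℕ} {y : ℝ} (hlow : ∀ j < s, (j : ℝ) < y) (hy : y < s)
    (hn : s ≤ n) : 0 ≤ (-1) ^ s * ((-2) ^ n * ∏ j ∈ range n, (y - j)) := by
  induction n, hn using Nat.le_induction with
  | base =>
    rw [← mul_assoc, ← mul_pow]
    exact mul_nonneg (by norm_num)
      (prod_nonneg fun j hj => sub_nonneg.mpr (hlow j (mem_range.mp hj)).le)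
  | succ n hn ih =>
    rw [prod_range_succ, pow_succ]
    have hyn : y < n := hy.trans_le (by exact_mod_cast hn)
    have := mul_nonneg ih (by linarith : 0 ≤ 2 * (n - y))
    linarith

theorem altPoly_mono {s m n : ℕ} {y : ℝ} (hlow : ∀ j < s, (j : ℝ) < y) (hy : y < s)
    (hm : s ≤ m) (hmn : m ≤ n) :
    (-1) ^ s * (altPoly m).eval y ≤ (-1) ^ s * (altPoly n).eval y := by
  induction n, hmn using Nat.le_induction with
  | base => exact le_rfl
  | succ n hn ih =>
    refine ih.trans ?_
    have := newton_term_nonneg hlow hy (n := n + 1) (by omega)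
    rw [altPoly_succ_eval, mul_add]
    refine le_add_of_nonneg_right ?_
    rw [div_mul_eq_mul_div, mul_div_assoc']
    exact div_nonneg this (by positivity)

theorem one_lt_altPoly_of_neg {n : ℕ} (hn : 1 ≤ n) {y : ℝ} (hy : y < 0) :
    1 < (altPoly n).eval y := by
  have h := altPoly_mono (s := 0) (by simp) (by simpa using hy) (Nat.zero_le 1) hn
  have h1 : (altPoly 1).eval y = 1 - 2 * y := by
    simp [altPoly, sum_range_succ]
    ring
  simp only [pow_zero, one_mul] at h
  linarith

/-- Beyond the symmetric stencil, the alternating interpolant decreases in modulus at `s`. -/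
theorem exists_one_lt_altPoly_odd (s : ℕ) :
    ∃ t ∈ Set.Ioo (-1 : ℝ) 0, 1 < (-1) ^ s * (altPoly (2 * s + 1)).eval (s + t) := by
  set E : ℝ → ℝ := fun t => (altPoly (2 * s)).eval (s + t) with hE
  set R : ℝ → ℝ := fun t => ∏ i ∈ range s, (((i : ℝ) + 1) ^ 2 - t ^ 2) with hR
  set K : ℝ := 2 ^ (2 * s + 1) / ((2 * s + 1).factorial : ℝ) with hK
  have hss : ((-1 : ℝ) ^ s) * (-1) ^ s = 1 := by rw [← mul_pow]; norm_num
  have hform : ∀ t : ℝ, (-1) ^ s * (altPoly (2 * s + 1)).eval (s + t)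
      = (-1) ^ s * E t - K * (t * R t) := by
    intro t
    have hneg : (-2 : ℝ) ^ (2 * s + 1) = -2 ^ (2 * s + 1) := Odd.neg_pow ⟨s, rfl⟩ 2
    rw [altPoly_succ_eval, prod_even, hneg]
    simp only [hE, hR, hK]
    linear_combination (-(2 ^ (2 * s + 1) / ((2 * s + 1).factorial : ℝ)) *
      (t * ∏ i ∈ range s, (((i : ℝ) + 1) ^ 2 - t ^ 2))) * hss
  have heven : ∀ t, E (-t) = E t := by
    intro t
    have := altPoly_eval_sub (2 * s) (s + t)
    rw [pow_mul, neg_one_sq, one_pow, one_mul] at this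
    simp only [hE]
    rw [← this]
    push_cast
    ring_nf
  have hEd : HasDerivAt E 0 0 := by
    have hdiff : DifferentiableAt ℝ E 0 :=
      (altPoly (2 * s)).differentiable.comp (differentiable_id.const_add (s : ℝ)) 0
    have h0 : deriv E 0 = 0 := by
      have h1 : deriv (fun t => E (-t)) 0 = -deriv E (-0) := deriv_comp_neg E 0
      rw [funext heven, neg_zero] at h1
      linarith
    exact hdiff.hasDerivAt.congr_deriv h0
  have hRd : DifferentiableAt ℝ R 0 := by
    simp only [hR]
    fun_prop
  have hR0 : 0 < R 0 := prod_pos fun i _ => by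
    rw [zero_pow two_ne_zero, sub_zero]
    positivity
  have hK0 : 0 < K := by positivity
  have hgd : HasDerivAt (fun t : ℝ => (-1) ^ s * (altPoly (2 * s + 1)).eval (s + t))
      (-(K * R 0)) 0 := by
    rw [funext hform]
    refine ((hEd.const_mul _).sub
      (((hasDerivAt_id (0 : ℝ)).mul hRd.hasDerivAt).const_mul K)).congr_deriv ?_
    simp
  have hev := (hasDerivWithinAt_iff_tendsto_slope.mp
    (hgd.hasDerivWithinAt (s := Set.Iio 0))).eventually (gt_mem_nhds (neg_neg_of_pos (mul_pos hK0 hR0)))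
  rw [Set.sdiff_singleton_eq_self (by simp)] at hev
  obtain ⟨t, hslope, ht⟩ :=
    (hev.and (Ioo_mem_nhdsLT (show (-1 : ℝ) < 0 by norm_num))).exists
  refine ⟨t, ht, ?_⟩
  have h0 : (-1) ^ s * (altPoly (2 * s + 1)).eval (s + (0 : ℝ)) = 1 := by
    rw [add_zero, altPoly_eval_nat (by omega), hss]
  rw [slope_def_field, h0, sub_zero, div_neg_iff] at hslope
  rcases hslope with h | h
  · linarith [h.1]
  · linarith [h.2, ht.2]

theorem exists_one_lt_abs_altPoly {s n : ℕ} (hn : 2 * s + 1 ≤ n) :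
    ∃ y ∈ Set.Ioo ((s : ℝ) - 1) s, 1 < |(altPoly n).eval y| := by
  obtain ⟨t, ht, h⟩ := exists_one_lt_altPoly_odd s
  refine ⟨s + t, ⟨by linarith [ht.1], by linarith [ht.2]⟩, ?_⟩
  have hmono := altPoly_mono (y := s + t) (fun j hj => by
    have : (j : ℝ) + 1 ≤ s := by exact_mod_cast hj
    linarith [ht.1]) (by linarith [ht.2]) (by omega : s ≤ 2 * s + 1) hn
  have habs := le_abs_self ((-1) ^ s * (altPoly n).eval ((s : ℝ) + t))
  rw [abs_mul, abs_pow, abs_neg, abs_one, one_pow, one_mul] at habs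
  linarith

theorem Reproduces.alternating_sum {p : ℕ} {f : ℕ → ℝ} {y : ℝ} (h : Reproduces p f y) :
    ∑ i ∈ range (p + 1), f i * (-1) ^ i = (altPoly p).eval y := by
  rw [← h _ (natDegree_altPoly_le p)]
  exact sum_congr rfl fun i hi => by
    rw [altPoly_eval_nat (Nat.lt_succ_iff.mp (mem_range.mp hi))]

end IserlesStrang

open IserlesStrang

/-- Iserles–Strang order barrier: the unique order-`p` explicit scheme on the
stencil `{k−p, …, k}` has non-increasing `ℓ²(ℤ)` norm for all CFL numbers `ν ∈ (0,1]`
if and only if `p ∈ {2k, 2k+1, 2k+2}`. -/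
theorem iserles_strang_order_barrier
    (p k : ℕ) (hp : 1 ≤ p)
    (α : ℝ → ℤ → ℝ)
    (hα : ∀ ν ∈ Set.Ioc (0 : ℝ) 1, ∀ m : ℕ, m ≤ p →
      ∑ r ∈ Finset.Icc ((k : ℤ) - (p : ℤ)) (k : ℤ), α ν r * (r : ℝ) ^ m = (-ν) ^ m) :
    (∀ ν ∈ Set.Ioc (0 : ℝ) 1, ∀ c : ℤ → ℝ, Summable (fun j : ℤ => (c j) ^ 2) →
      ∑' j : ℤ, (∑ r ∈ Finset.Icc ((k : ℤ) - (p : ℤ)) (k : ℤ), α ν r * c (j + r)) ^ 2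
        ≤ ∑' j : ℤ, (c j) ^ 2)
    ↔ (p = 2 * k ∨ p = 2 * k + 1 ∨ p = 2 * k + 2) := by
  set a : ℤ := (k : ℤ) - p with ha
  have hk : (k : ℤ) = a + p := by rw [ha]; ring
  have hIcc : ∀ g : ℤ → ℝ,
      ∑ r ∈ Finset.Icc a (k : ℤ), g r = ∑ i ∈ Finset.range (p + 1), g (a + i) := fun g => by
    rw [hk, sum_Icc_int_eq_sum_range]
  have hrep : ∀ ν ∈ Set.Ioc (0 : ℝ) 1, Reproduces p (fun i => α ν (a + i)) (p - k - ν) := by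
    intro ν hν
    have h := hα ν hν
    rw [hk] at h
    have := reproduces_of_moments h
    rwa [show -ν - (a : ℝ) = p - k - ν by rw [ha]; push_cast; ring] at this
  simp_rw [hIcc]
  constructor
  · intro hcontr
    have hbound : ∀ ν ∈ Set.Ioc (0 : ℝ) 1, |(altPoly p).eval (p - k - ν)| ≤ 1 := by
      intro ν hν
      rw [← (hrep ν hν).alternating_sum]
      exact abs_alternating_sum_le_one a (hcontr ν hν)
    by_contra hne
    rcases lt_or_ge p k with hpk | hpk
    · have hpk' : (p : ℝ) < k := by exact_mod_cast hpk
      have h1 := one_lt_altPoly_of_neg hp (y := p - k - 1 / 2) (by linarith)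
      have h2 := hbound (1 / 2) ⟨by norm_num, by norm_num⟩
      linarith [le_abs_self ((altPoly p).eval ((p : ℝ) - k - 1 / 2))]
    rcases lt_or_ge p (2 * k) with h2k | h2k
    · obtain ⟨y, hy, h1⟩ := exists_one_lt_abs_altPoly (s := p - k) (n := p) (by omega)
      rw [Nat.cast_sub hpk] at hy
      have h2 := hbound (p - k - y) ⟨by linarith [hy.2], by linarith [hy.1]⟩
      rw [sub_sub_cancel] at h2
      linarith
    · obtain ⟨y, hy, h1⟩ := exists_one_lt_abs_altPoly (s := k + 1) (n := p) (by omega)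
      push_cast at hy
      have h2 := hbound (y - k) ⟨by linarith [hy.1], by linarith [hy.2]⟩
      rw [sub_sub_sub_cancel_right, altPoly_eval_sub, abs_mul, abs_pow, abs_neg, abs_one,
        one_pow, one_mul] at h2
      linarith
  · intro hpk ν hν c hc
    refine tsum_sq_conv_le (f := fun i => α ν (a + i)) a (fun θ h0 hπ => ?_) hc
    have h := hrep ν hν
    obtain ⟨hν0, hν1⟩ := hν
    rcases hpk with rfl | rfl | rfl
    · rw [show ((2 * k : ℕ) : ℝ) - k - ν = k + -ν by push_cast; ring] at h
      exact h.symbol_le_one_even (by omega) (abs_le.mpr ⟨by linarith, by linarith⟩) h0 hπ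
    · rw [show ((2 * k + 1 : ℕ) : ℝ) - k - ν = k + 1 / 2 + (1 / 2 - ν) by push_cast; ring] at h
      exact h.symbol_le_one_odd (abs_le.mpr ⟨by linarith, by linarith⟩) h0 hπ
    · rw [show ((2 * k + 2 : ℕ) : ℝ) - k - ν = (k + 1 : ℕ) + (1 - ν) by push_cast; ring] at h
      exact h.symbol_le_one_even (q := k + 1) (by omega)
        (abs_le.mpr ⟨by linarith, by linarith⟩) h0 hπ
end

section
/- (L^q stability of odd-order IS-schemes.) Let k ≥ 0 be an integer and p = 2k+1. For ν ∈ (0,1] let α_{k−p}(ν), …, α_k(ν) be the unique coefficients on the stencil {k−p, …, k} satisfying the order-p conditions Σ_{r=k−p}^{k} α_r(ν) r^m = (−ν)^m for m = 0, …, p, and let (Hc)_j = Σ_{r=k−p}^{k} α_r(ν) c_{j+r} be the associated scheme (which is ℓ²-non-increasing for all ν ∈ (0,1]). Then there exists a constant D_p > 0, depending only on p, such that for every q ∈ [1, ∞], every ν ∈ (0,1], every initial sequence c^0 ∈ ℓ^q(ℤ) and every n ≥ 0, the iterates c^n = H^n c^0 satisfy ‖c^n‖_{ℓ^q} ≤ D_p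 ‖c^0‖_{ℓ^q}. -/
open MeasureTheory ENNReal

open Polynomial in
lemma integral_norm_aeval_exp_sq (P : ℝ[X]) {N : ℕ} (hN : P.natDegree < N) :
    ∫ θ in (-Real.pi)..Real.pi, ‖aeval (Complex.exp (θ * Complex.I)) P‖ ^ 2
      = 2 * Real.pi * ∑ j ∈ Finset.range N, P.coeff j ^ 2 := by
  have key : ∀ θ : ℝ, ‖aeval (Complex.exp (θ * Complex.I)) P‖ ^ 2
      = ∑ i ∈ Finset.range N, ∑ j ∈ Finset.range N,
          P.coeff i * P.coeff j * Real.cos (((i : ℤ) - (j : ℤ) : ℤ) * θ) := by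
    intro θ
    have h1 : aeval (Complex.exp (θ * Complex.I)) P
        = ((∑ j ∈ Finset.range N, P.coeff j * Real.cos (j * θ) : ℝ) : ℂ)
          + ((∑ j ∈ Finset.range N, P.coeff j * Real.sin (j * θ) : ℝ) : ℂ) * Complex.I := by
      rw [aeval_eq_sum_range' hN]
      push_cast
      rw [Finset.sum_mul, ← Finset.sum_add_distrib]
      refine Finset.sum_congr rfl fun j _ => ?_
      rw [← Complex.exp_nat_mul, ← mul_assoc, Complex.exp_mul_I, Complex.real_smul]
      ring
    rw [h1, Complex.sq_norm, Complex.normSq_add_mul_I, sq, sq, Finset.sum_mul_sum,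
      Finset.sum_mul_sum, ← Finset.sum_add_distrib]
    refine Finset.sum_congr rfl fun i _ => ?_
    rw [← Finset.sum_add_distrib]
    refine Finset.sum_congr rfl fun j _ => ?_
    push_cast
    rw [sub_mul, Real.cos_sub]
    ring
  have hcos : ∀ m : ℤ, ∫ θ in (-Real.pi)..Real.pi, Real.cos (m * θ)
      = if m = 0 then 2 * Real.pi else 0 := by
    intro m
    split_ifs with hm
    · simp [hm]; ring
    · have hm' : (m : ℝ) ≠ 0 := by exact_mod_cast hm
      rw [intervalIntegral.integral_comp_mul_left (fun x => Real.cos x) hm']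
      simp [Real.sin_int_mul_pi]
  simp_rw [key]
  rw [intervalIntegral.integral_finsetSum
    (fun i _ => (by fun_prop : Continuous _).intervalIntegrable _ _), Finset.mul_sum]
  refine Finset.sum_congr rfl fun i hi => ?_
  rw [intervalIntegral.integral_finsetSum
    (fun i _ => (by fun_prop : Continuous _).intervalIntegrable _ _)]
  simp_rw [intervalIntegral.integral_const_mul, hcos]
  rw [Finset.sum_eq_single_of_mem i hi]
  · simp; ring
  · intro j _ hj
    rw [if_neg (by omega), mul_zero]

lemma sum_inv_one_add_sq_le {l : ℝ} (hl : 0 < l) (hl1 : l ≤ 1) (x : ℝ) (N : ℕ) :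
    l * ∑ j ∈ Finset.range N, 1 / (1 + l ^ 2 * ((j : ℝ) - x) ^ 2) ≤ 3 * Real.pi := by
  have step : ∀ t : ℝ, l * (1 / (1 + l ^ 2 * t ^ 2))
      ≤ 3 * (Real.arctan (l * (t + 1)) - Real.arctan (l * t)) := by
    intro t
    have hd : ∀ s, HasDerivAt (fun s => Real.arctan (l * s)) (1 / (1 + (l * s) ^ 2) * l) s :=
      fun s => by simpa using ((hasDerivAt_id s).const_mul l).arctan
    obtain ⟨s, hs, hs'⟩ := exists_hasDerivAt_eq_slope (fun s => Real.arctan (l * s)) _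
      (lt_add_one t) (fun s _ => (hd s).continuousAt.continuousWithinAt) (fun s _ => hd s)
    rw [add_sub_cancel_left, div_one] at hs'
    rw [← hs']
    have h3 : 1 + (l * s) ^ 2 ≤ 3 * (1 + l ^ 2 * t ^ 2) := by
      have : s ^ 2 ≤ 2 * t ^ 2 + 2 := by nlinarith [hs.1, hs.2, sq_nonneg (s - 2 * t)]
      nlinarith [mul_le_mul_of_nonneg_left this (sq_nonneg l), mul_le_one₀ hl1 hl.le hl1]
    have : 1 / (1 + l ^ 2 * t ^ 2) ≤ 3 * (1 / (1 + (l * s) ^ 2)) := by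
      rw [mul_one_div, div_le_div_iff₀ (by positivity) (by positivity)]
      linarith
    nlinarith
  rw [Finset.mul_sum]
  calc _ ≤ ∑ j ∈ Finset.range N, 3 * (Real.arctan (l * (((j + 1 : ℕ) : ℝ) - x))
          - Real.arctan (l * ((j : ℝ) - x))) := by
        refine Finset.sum_le_sum fun j _ => (step _).trans_eq ?_
        push_cast
        congr 4; ring
    _ = 3 * (Real.arctan (l * ((N : ℝ) - x)) - Real.arctan (l * (((0 : ℕ) : ℝ) - x))) := by
        rw [← Finset.mul_sum, Finset.sum_range_sub (fun j : ℕ => Real.arctan (l * ((j : ℝ) - x)))]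
    _ ≤ _ := by
        rw [Nat.cast_zero]
        linarith [Real.arctan_lt_pi_div_two (l * ((N : ℝ) - x)),
          Real.neg_pi_div_two_lt_arctan (l * (0 - x))]

lemma integral_inv_one_add_sq_le {l : ℝ} (hl : 0 < l) (a b : ℝ) :
    ∫ θ in a..b, 1 / (1 + (θ / l) ^ 2) ≤ Real.pi * l := by
  rw [intervalIntegral.integral_comp_div (fun x => 1 / (1 + x ^ 2)) hl.ne',
    integral_one_div_one_add_sq, smul_eq_mul, mul_comm]
  gcongr
  linarith [Real.arctan_lt_pi_div_two (b / l), Real.neg_pi_div_two_lt_arctan (a / l)]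

lemma prod_range_erase_sub {n i : ℕ} (hi : i ≤ n) :
    ∏ l ∈ (Finset.range (n + 1)).erase i, ((i : ℝ) - l)
      = (-1) ^ (n - i) * (i.factorial * (n - i).factorial) := by
  have hs : (Finset.range (n + 1)).erase i
      = (Finset.range i).disjUnion (Finset.Ico (i + 1) (n + 1)) (by
        rw [Finset.disjoint_left]; intro x; simp; omega) := by
    ext x; simp; omega
  rw [hs, Finset.prod_disjUnion, Finset.prod_Ico_eq_prod_range, Nat.add_sub_add_right,
    ← Finset.prod_range_add_one_eq_factorial i, ← Finset.prod_range_add_one_eq_factorial (n - i),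
    ← Finset.prod_range_reflect]
  have h1 : ∏ j ∈ Finset.range i, ((i : ℝ) - (i - 1 - j : ℕ))
      = ((∏ x ∈ Finset.range i, (x + 1) : ℕ) : ℝ) := by
    push_cast
    refine Finset.prod_congr rfl fun j hj => ?_
    have := Finset.mem_range.1 hj
    rw [Nat.sub_sub, Nat.cast_sub (by omega)]; push_cast; ring
  have h2 : ∏ j ∈ Finset.range (n - i), ((i : ℝ) - (i + 1 + j : ℕ))
      = (-1) ^ (n - i) * ((∏ x ∈ Finset.range (n - i), (x + 1) : ℕ) : ℝ) := by
    push_cast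
    conv_rhs => enter [1, 2]; rw [← Finset.card_range (n - i)]
    rw [← Finset.prod_const, ← Finset.prod_mul_distrib]
    refine Finset.prod_congr rfl fun j hj => ?_
    ring
  rw [h1, h2]; ring

lemma one_sub_div_pi_le_of_hasDerivAt {k : ℕ} {y c : ℝ} (hy : |y| < 1 / 2) (hc : 0 ≤ c)
    {E O : ℝ → ℝ}
    (hE : ∀ θ, HasDerivAt E (-y * O θ - c * (2 * Real.sin (θ / 2)) ^ (2 * k + 1)) θ)
    (hO : ∀ θ, HasDerivAt O (y * E θ) θ) (hE0 : E 0 = 1) (hO0 : O 0 = 0)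
    (hEpi : E Real.pi = 0) {θ : ℝ} (hθ : θ ∈ Set.Icc 0 Real.pi) :
    1 - θ / Real.pi ≤ E θ := by
  have hpi := Real.pi_pos
  have hsin : ∀ x : ℝ, HasDerivAt (fun x => (2 * Real.sin (x / 2)) ^ (2 * k + 1))
      ((2 * k + 1) * (2 * Real.sin (x / 2)) ^ (2 * k) * Real.cos (x / 2)) x := by
    intro x
    have h := ((((hasDerivAt_id x).div_const 2).sin.const_mul 2).pow (2 * k + 1))
    refine h.congr_deriv ?_
    push_cast
    simp only [id]
    ring
  have hcos0 : ∀ x ∈ Set.Icc 0 Real.pi, 0 ≤ Real.cos (x / 2) := fun x hx =>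
    Real.cos_nonneg_of_mem_Icc ⟨by linarith [hx.1], by linarith [hx.2]⟩
  have hcosy : ∀ x ∈ Set.Icc 0 Real.pi, 0 < Real.cos (y * x) := by
    intro x hx
    have h1 : |y * x| < Real.pi / 2 := by
      rw [abs_mul, abs_of_nonneg hx.1]
      nlinarith [hx.1, hx.2, abs_nonneg y]
    exact Real.cos_pos_of_mem_Ioo (abs_lt.1 h1)
  have hpos : ∀ x : ℝ, x ∈ Set.Icc 0 Real.pi →
      0 ≤ c * ((2 * k + 1) * (2 * Real.sin (x / 2)) ^ (2 * k) * Real.cos (x / 2)) := by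
    intro x hx
    have h1 := hcos0 x hx
    have h2 : 0 ≤ (2 * Real.sin (x / 2)) ^ (2 * k) := by rw [pow_mul]; positivity
    positivity
  have hcy : ∀ x, HasDerivAt (fun x => Real.cos (y * x)) (-y * Real.sin (y * x)) x := fun x => by
    simpa [mul_comm] using ((hasDerivAt_id x).const_mul y).cos
  have hsy : ∀ x, HasDerivAt (fun x => Real.sin (y * x)) (y * Real.cos (y * x)) x := fun x => by
    simpa [mul_comm] using ((hasDerivAt_id x).const_mul y).sin
  have hE' : ∀ x, HasDerivAt (fun x => -y * O x - c * (2 * Real.sin (x / 2)) ^ (2 * k + 1))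
      (-y * (y * E x) - c * ((2 * k + 1) * (2 * Real.sin (x / 2)) ^ (2 * k) * Real.cos (x / 2)))
      x := fun x => ((hO x).const_mul (-y)).sub ((hsin x).const_mul c)
  obtain ⟨W, hW⟩ : ∃ W : ℝ → ℝ, W = fun x => (-y * O x - c * (2 * Real.sin (x / 2)) ^ (2 * k + 1)) * Real.cos (y * x)
    + y * (E x * Real.sin (y * x)) := ⟨_, rfl⟩
  have hWd : ∀ x, HasDerivAt W
      (-(c * ((2 * k + 1) * (2 * Real.sin (x / 2)) ^ (2 * k) * Real.cos (x / 2)))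
        * Real.cos (y * x)) x := by
    intro x
    rw [hW]
    refine (((hE' x).mul (hcy x)).add (((hE x).mul (hsy x)).const_mul y)).congr_deriv ?_
    ring
  have hWanti : AntitoneOn W (Set.Icc 0 Real.pi) := by
    refine antitoneOn_of_hasDerivWithinAt_nonpos (convex_Icc _ _)
      (fun x _ => (hWd x).continuousAt.continuousWithinAt)
      (fun x _ => (hWd x).hasDerivWithinAt) fun x hx => ?_
    have hx := interior_subset hx
    nlinarith [mul_nonneg (hpos x hx) (hcosy x hx).le]
  have hW0 : ∀ x ∈ Set.Icc 0 Real.pi, W x ≤ 0 := by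
    intro x hx
    refine (hWanti ⟨le_rfl, hpi.le⟩ hx hx.1).trans_eq ?_
    simp [hW, hO0]
  have hRd : ∀ x ∈ Set.Icc 0 Real.pi, HasDerivAt (fun x => E x / Real.cos (y * x))
      (W x / Real.cos (y * x) ^ 2) x := by
    intro x hx
    refine ((hE x).div (hcy x) (hcosy x hx).ne').congr_deriv ?_
    rw [hW]; ring
  have hRanti : AntitoneOn (fun x => E x / Real.cos (y * x)) (Set.Icc 0 Real.pi) := by
    refine antitoneOn_of_hasDerivWithinAt_nonpos (convex_Icc _ _)
      (fun x hx => (hRd x hx).continuousAt.continuousWithinAt)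
      (fun x hx => (hRd x (interior_subset hx)).hasDerivWithinAt) fun x hx => ?_
    exact div_nonpos_of_nonpos_of_nonneg (hW0 x (interior_subset hx)) (sq_nonneg _)
  have hE_nonneg : ∀ x ∈ Set.Icc 0 Real.pi, 0 ≤ E x := by
    intro x hx
    have h := hRanti hx ⟨hpi.le, le_rfl⟩ hx.2
    simp only [hEpi, zero_div] at h
    by_contra! hneg
    exact absurd (div_neg_of_neg_of_pos hneg (hcosy x hx)) h.not_gt
  have hconc : ConcaveOn ℝ (Set.Icc 0 Real.pi) E := by
    refine concaveOn_of_hasDerivWithinAt2_nonpos (convex_Icc _ _)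
      (fun x _ => (hE x).continuousAt.continuousWithinAt)
      (fun x _ => (hE x).hasDerivWithinAt) (fun x _ => (hE' x).hasDerivWithinAt) fun x hx => ?_
    have hx := interior_subset hx
    nlinarith [hpos x hx, mul_nonneg (sq_nonneg y) (hE_nonneg x hx)]
  have h := hconc.2 (Set.left_mem_Icc.2 hpi.le) (Set.right_mem_Icc.2 hpi.le)
    (sub_nonneg.2 ((div_le_one hpi).2 hθ.2)) (div_nonneg hθ.1 hpi.le) (sub_add_cancel 1 _)
  simpa [hE0, hEpi, hpi.ne'] using h

open Polynomial in
lemma norm_aeval_exp_sq_le {k : ℕ} {y c : ℝ} {B : ℝ[X]} (hy : c = 0 ∨ |y| < 1 / 2) (hc : 0 ≤ c)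
    (hB1 : B.eval 1 = 1)
    (hB : X * derivative B - C (k + 1 / 2 + y) * B = C ((-1) ^ k * c) * (X - 1) ^ (2 * k + 1))
    {θ : ℝ} (hθ : |θ| ≤ Real.pi) :
    ‖aeval (Complex.exp (θ * Complex.I)) B‖ ^ 2
      ≤ 1 - 1 / (k + 1) * c * Real.sin (θ / 2) ^ (2 * k + 2) := by
  wlog h0 : 0 ≤ θ generalizing θ
  · have h := this (θ := -θ) (by rwa [abs_neg]) (by linarith)
    have hconj : Complex.exp (((-θ : ℝ) : ℂ) * Complex.I)
        = (starRingEnd ℂ) (Complex.exp (θ * Complex.I)) := by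
      rw [← Complex.exp_conj]; simp
    rw [hconj, aeval_conj, RCLike.norm_conj, neg_div, Real.sin_neg,
      Even.neg_pow ⟨k + 1, by ring⟩] at h
    exact h
  have hθ' : θ ∈ Set.Icc 0 Real.pi := ⟨h0, (abs_of_nonneg h0) ▸ hθ⟩
  have hpi := Real.pi_pos
  set G : ℝ → ℂ := fun t => Complex.exp (-(k + 1 / 2) * (t * Complex.I))
    * aeval (Complex.exp (t * Complex.I)) B with hG
  have hGd : ∀ t : ℝ, HasDerivAt G
      (y * Complex.I * G t - (c * (2 * Real.sin (t / 2)) ^ (2 * k + 1) : ℝ)) t := by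
    intro t
    have h1 : HasDerivAt (fun t : ℝ => (t : ℂ) * Complex.I) Complex.I t := by
      simpa using (Complex.ofRealCLM.hasDerivAt (x := t)).mul_const Complex.I
    have h2 := (h1.const_mul (-((k : ℂ) + 1 / 2))).cexp
    have h3 := (B.hasDerivAt_aeval (Complex.exp (t * Complex.I))).comp t h1.cexp
    refine (h2.mul h3).congr_deriv ?_
    have h4 := congrArg (aeval (Complex.exp (t * Complex.I))) hB
    simp only [map_sub, map_mul, aeval_X, aeval_C, map_pow, map_one] at h4
    have h5 : Complex.exp (t * Complex.I) - 1
        = 2 * Complex.I * Real.sin (t / 2) * Complex.exp (t / 2 * Complex.I) := by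
      rw [Complex.ofReal_sin, Complex.sin]
      push_cast
      have e1 : Complex.exp (t * Complex.I)
          = Complex.exp (t / 2 * Complex.I) * Complex.exp (t / 2 * Complex.I) := by
        rw [← Complex.exp_add]; ring_nf
      have e2 : Complex.exp (-(t / 2) * Complex.I) * Complex.exp (t / 2 * Complex.I) = 1 := by
        rw [← Complex.exp_add]; simp
      linear_combination e1 + e2 - (Complex.exp (-(t / 2) * Complex.I) -
        Complex.exp (t / 2 * Complex.I)) * Complex.exp (t / 2 * Complex.I) * Complex.I_sq
    have h6 : Complex.exp (-(k + 1 / 2) * (t * Complex.I))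
        * Complex.exp (t / 2 * Complex.I) ^ (2 * k + 1) = 1 := by
      rw [← Complex.exp_nat_mul, ← Complex.exp_add, Complex.exp_eq_one_iff]
      exact ⟨0, by push_cast; ring⟩
    have h7 : (-1 : ℂ) ^ k * Complex.I ^ (2 * k + 1) = Complex.I := by
      rw [pow_succ, pow_mul, Complex.I_sq, ← mul_assoc, ← mul_pow]; simp
    rw [h5] at h4
    simp only [mul_pow, Complex.coe_algebraMap] at h4
    simp only [hG, Function.comp]
    push_cast at h4 ⊢
    simp only [mul_pow]
    set e := Complex.exp (-(k + 1 / 2) * (t * Complex.I))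
    set w := Complex.exp (t / 2 * Complex.I) ^ (2 * k + 1)
    set S := Complex.sin (t / 2) ^ (2 * k + 1)
    linear_combination e * Complex.I * h4
      + c * 2 ^ (2 * k + 1) * S * (Complex.I * (-1) ^ k * Complex.I ^ (2 * k + 1)) * h6
      + c * 2 ^ (2 * k + 1) * S * Complex.I * h7 + c * 2 ^ (2 * k + 1) * S * Complex.I_sq
  have hE : ∀ t, HasDerivAt (fun t => (G t).re)
      (-y * (G t).im - c * (2 * Real.sin (t / 2)) ^ (2 * k + 1)) t := by
    intro t
    refine (Complex.reCLM.hasFDerivAt.comp_hasDerivAt t (hGd t)).congr_deriv ?_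
    rw [Complex.reCLM_apply, Complex.sub_re, Complex.ofReal_re]
    simp
  have hO : ∀ t, HasDerivAt (fun t => (G t).im) (y * (G t).re) t := by
    intro t
    refine (Complex.imCLM.hasFDerivAt.comp_hasDerivAt t (hGd t)).congr_deriv ?_
    rw [Complex.imCLM_apply, Complex.sub_im, Complex.ofReal_im]
    simp
  have haeval : ∀ r : ℝ, aeval (r : ℂ) B = ((B.eval r : ℝ) : ℂ) := fun r => by
    rw [← Complex.coe_algebraMap, aeval_algebraMap_apply]; simp
  have hG0 : G 0 = 1 := by
    have := haeval 1
    simp only [Complex.ofReal_one, hB1] at this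
    simp [hG, this]
  have hGpi : (G Real.pi).re = 0 := by
    have h1 : Complex.exp (-(k + 1 / 2) * (Real.pi * Complex.I)) = (-1) ^ k * -Complex.I := by
      have : -((k : ℂ) + 1 / 2) * (Real.pi * Complex.I)
          = (k : ℕ) * (-(Real.pi * Complex.I)) + -(Real.pi / 2 * Complex.I) := by ring
      rw [this, Complex.exp_add, Complex.exp_nat_mul, Complex.exp_neg, Complex.exp_neg,
        Complex.exp_pi_mul_I, Complex.exp_pi_div_two_mul_I]
      simp
    have h2 := haeval (-1)
    simp only [Complex.ofReal_neg, Complex.ofReal_one] at h2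
    simp only [hG, h1, Complex.exp_pi_mul_I, h2]
    have : ((-1 : ℂ) ^ k * -Complex.I) * ((B.eval (-1) : ℝ) : ℂ)
        = ((-((-1) ^ k * B.eval (-1)) : ℝ) : ℂ) * Complex.I := by push_cast; ring
    rw [this, Complex.re_ofReal_mul, Complex.I_re, mul_zero]
  have hlow : ∀ t ∈ Set.Icc 0 Real.pi,
      c * Real.cos (t / 2) ≤ c * (4 * (G t).re) := by
    intro t ht
    rcases hy with hy | hy
    · simp [hy]
    · refine mul_le_mul_of_nonneg_left ?_ hc
      have h1 := one_sub_div_pi_le_of_hasDerivAt hy hc hE hO (by simp [hG0]) (by simp [hG0])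
        hGpi ht
      have h2 : Real.cos (t / 2) ≤ Real.pi / 2 - t / 2 := by
        rw [← Real.sin_pi_div_two_sub]
        exact Real.sin_le (by linarith [ht.2])
      have h3 : Real.pi / 2 - t / 2 = Real.pi / 2 * (1 - t / Real.pi) := by field_simp
      have h4 : 0 ≤ 1 - t / Real.pi := sub_nonneg.2 ((div_le_one hpi).2 ht.2)
      nlinarith [Real.pi_le_four]
  have hs : ∀ t, HasDerivAt (fun t => 1 / (k + 1) * c * Real.sin (t / 2) ^ (2 * k + 2))
      (c * Real.cos (t / 2) * Real.sin (t / 2) ^ (2 * k + 1)) t := by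
    intro t
    refine (((((hasDerivAt_id t).div_const 2).sin).pow (2 * k + 2)).const_mul _).congr_deriv ?_
    have : (k : ℝ) + 1 ≠ 0 := by positivity
    simp only [id]
    push_cast
    field_simp
  have hΦd : ∀ t, HasDerivAt (fun t => (G t).re ^ 2 + (G t).im ^ 2
      + 1 / (k + 1) * c * Real.sin (t / 2) ^ (2 * k + 2))
      ((c * Real.cos (t / 2) - c * (4 * 4 ^ k * (G t).re)) * Real.sin (t / 2) ^ (2 * k + 1)) t := by
    intro t
    refine ((((hE t).pow 2).add ((hO t).pow 2)).add (hs t)).congr_deriv ?_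
    have : (2 : ℝ) ^ (2 * k + 1) = 2 * 4 ^ k := by rw [pow_succ, pow_mul]; norm_num; ring
    rw [mul_pow, this]
    push_cast
    ring
  have hanti : AntitoneOn (fun t => (G t).re ^ 2 + (G t).im ^ 2
      + 1 / (k + 1) * c * Real.sin (t / 2) ^ (2 * k + 2)) (Set.Icc 0 Real.pi) := by
    refine antitoneOn_of_hasDerivWithinAt_nonpos (convex_Icc _ _)
      (fun x _ => (hΦd x).continuousAt.continuousWithinAt)
      (fun x _ => (hΦd x).hasDerivWithinAt) fun x hx => ?_
    have hx := interior_subset hx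
    have h1 := hlow x hx
    have h2 : 0 ≤ Real.sin (x / 2) :=
      Real.sin_nonneg_of_nonneg_of_le_pi (by linarith [hx.1]) (by linarith [hx.2])
    have h3 : 0 ≤ Real.cos (x / 2) :=
      Real.cos_nonneg_of_mem_Icc ⟨by linarith [hx.1], by linarith [hx.2]⟩
    have h4 : (1 : ℝ) ≤ 4 ^ k := one_le_pow₀ (by norm_num)
    refine mul_nonpos_of_nonpos_of_nonneg ?_ (by positivity)
    have h5 : 0 ≤ c * (4 * (G x).re) := (mul_nonneg hc h3).trans h1
    nlinarith
  have h := hanti (Set.left_mem_Icc.2 hpi.le) hθ' h0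
  simp only [hG0, Complex.one_re, Complex.one_im, zero_div, Real.sin_zero] at h
  have hnorm : ‖aeval (Complex.exp (θ * Complex.I)) B‖ ^ 2 = (G θ).re ^ 2 + (G θ).im ^ 2 := by
    have h1 : ‖Complex.exp (-(k + 1 / 2) * (θ * Complex.I))‖ = 1 := by
      rw [Complex.norm_exp]; simp
    rw [sq (G θ).re, sq (G θ).im, ← Complex.normSq_apply, ← Complex.sq_norm, hG, norm_mul, h1,
      one_mul]
  rw [hnorm]
  have h8 : (0 : ℝ) ^ (2 * k + 2) = 0 := zero_pow (by omega)
  rw [h8] at h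
  linarith

lemma sum_Icc_eq_sum_range {M : Type*} [AddCommMonoid M] (k : ℕ) (f : ℤ → M) :
    ∑ r ∈ Finset.Icc ((k : ℤ) - ((2 * k + 1 : ℕ) : ℤ)) (k : ℤ), f r
      = ∑ i ∈ Finset.range (2 * k + 2), f ((i : ℤ) - (k + 1)) := by
  refine Finset.sum_nbij' (fun r => (r + (k + 1)).toNat) (fun i => (i : ℤ) - (k + 1)) ?_ ?_ ?_ ?_ ?_
  · intro r hr; simp at hr ⊢; omega
  · intro i hi; simp at hi ⊢; omega
  · intro r hr; simp at hr ⊢; omega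
  · intro i hi; simp
  · intro r hr; simp at hr; congr 1; omega

open Polynomial in
lemma sum_mul_eval_of_moments {k : ℕ} {ν : ℝ} {α : ℤ → ℝ}
    (hα : ∀ m : ℕ, m ≤ 2 * k + 1 →
      ∑ i ∈ Finset.range (2 * k + 2), α ((i : ℤ) - (k + 1)) * (((i : ℤ) - (k + 1) : ℤ) : ℝ) ^ m
        = (-ν) ^ m)
    {P : ℝ[X]} (hP : P.natDegree < 2 * k + 2) :
    ∑ i ∈ Finset.range (2 * k + 2), α ((i : ℤ) - (k + 1)) * P.eval (((i : ℤ) - (k + 1) : ℤ) : ℝ)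
      = P.eval (-ν) := by
  simp_rw [eval_eq_sum_range' hP, Finset.mul_sum]
  rw [Finset.sum_comm]
  refine Finset.sum_congr rfl fun m hm => ?_
  rw [← hα m (by simp at hm; omega), Finset.mul_sum]
  exact Finset.sum_congr rfl fun i _ => by ring

open Polynomial in
lemma exists_X_mul_derivative_sub_eq {k : ℕ} {ν : ℝ} (hν : ν ∈ Set.Ioc (0 : ℝ) 1) {α : ℤ → ℝ}
    (hα : ∀ m : ℕ, m ≤ 2 * k + 1 →
      ∑ i ∈ Finset.range (2 * k + 2), α ((i : ℤ) - (k + 1)) * (((i : ℤ) - (k + 1) : ℤ) : ℝ) ^ m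
        = (-ν) ^ m)
    {B : ℝ[X]} (hB : B = ∑ i ∈ Finset.range (2 * k + 2), C (α ((i : ℤ) - (k + 1))) * X ^ i) :
    ∃ c : ℝ, 0 ≤ c ∧ (c = 0 ∨ |1 / 2 - ν| < 1 / 2) ∧
      X * derivative B - C (k + 1 / 2 + (1 / 2 - ν)) * B
        = C ((-1) ^ k * c) * (X - 1) ^ (2 * k + 1) := by
  set a : ℝ := k + 1 / 2 + (1 / 2 - ν) with ha
  set ω : ℝ := ∏ l ∈ Finset.range (2 * k + 2), (a - l) with hω
  have hcoeff : ∀ i, B.coeff i = if i < 2 * k + 2 then α ((i : ℤ) - (k + 1)) else 0 := by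
    intro i; simp [hB, coeff_X_pow]
  have hα' : ∀ i < 2 * k + 2, α ((i : ℤ) - (k + 1)) * (a - i)
      * ((-1) ^ (2 * k + 1 - i) * (i.factorial * (2 * k + 1 - i).factorial)) = ω := by
    intro i hi
    have hi' : i ∈ Finset.range (2 * k + 2) := Finset.mem_range.2 hi
    have h := sum_mul_eval_of_moments hα
      (P := ∏ l ∈ (Finset.range (2 * k + 2)).erase i, (X - C ((l : ℝ) - (k + 1)))) (by
        rw [natDegree_prod_of_monic _ _ fun l _ => monic_X_sub_C _]
        simp only [natDegree_X_sub_C, Finset.sum_const, Finset.card_erase_of_mem hi']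
        simp)
    simp only [eval_prod, eval_sub, eval_X, eval_C] at h
    rw [Finset.sum_eq_single_of_mem i hi'] at h
    · rw [← prod_range_erase_sub (by omega : i ≤ 2 * k + 1), hω,
        ← Finset.mul_prod_erase _ _ hi', mul_right_comm, mul_comm (a - (i : ℝ))]
      congr 1
      convert h using 2
      · refine Finset.prod_congr rfl fun l _ => ?_
        push_cast; ring
      · rw [ha]; ring
    · intro j hj hji
      rw [Finset.prod_eq_zero (Finset.mem_erase.2 ⟨hji, hj⟩) (by push_cast; ring), mul_zero]
  have hsign : 0 ≤ (-1) ^ (k + 1) * ω := by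
    have : (-1) ^ (k + 1) * ω = (∏ l ∈ Finset.range (k + 1), (a - l))
        * ∏ l ∈ Finset.range (k + 1), (((k + 1 + l : ℕ) : ℝ) - a) := by
      rw [hω, show 2 * k + 2 = (k + 1) + (k + 1) by ring, Finset.prod_range_add, mul_left_comm]
      congr 1
      conv_lhs => enter [1, 2]; rw [← Finset.card_range (k + 1)]
      rw [← Finset.prod_const, ← Finset.prod_mul_distrib]
      exact Finset.prod_congr rfl fun l _ => by ring
    rw [this]
    refine mul_nonneg (Finset.prod_nonneg fun l hl => ?_) (Finset.prod_nonneg fun l hl => ?_)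
    · have : (l : ℝ) ≤ k := by exact_mod_cast Nat.lt_succ_iff.1 (Finset.mem_range.1 hl)
      linarith [hν.2]
    · push_cast
      have : (0 : ℝ) ≤ l := by positivity
      linarith [hν.1]
  refine ⟨(-1) ^ (k + 1) * ω / (2 * k + 1).factorial, by positivity, ?_, ?_⟩
  · rcases hν.2.lt_or_eq with h | h
    · right; rw [abs_lt]; constructor <;> linarith [hν.1]
    · left
      rw [hω, Finset.prod_eq_zero (i := k) (by simp; omega) (by rw [ha, h]; ring)]
      simp
  · ext i
    have hX : (X * derivative B).coeff i = i * B.coeff i := by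
      cases i with
      | zero => simp
      | succ i => rw [coeff_X_mul, coeff_derivative]; push_cast; ring
    have h1 : (X - 1 : ℝ[X]) ^ (2 * k + 1) = (X + C (-1)) ^ (2 * k + 1) := by
      simp [sub_eq_add_neg]
    rw [coeff_sub, hX, coeff_C_mul, coeff_C_mul, h1, coeff_X_add_C_pow, hcoeff]
    split_ifs with hi
    · have hfac : ((2 * k + 1).factorial : ℝ)
          = (2 * k + 1).choose i * (i.factorial * (2 * k + 1 - i).factorial) := by
        rw [← Nat.choose_mul_factorial_mul_factorial (by omega : i ≤ 2 * k + 1)]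
        push_cast; ring
      have hch : ((2 * k + 1).choose i : ℝ) ≠ 0 := by
        exact_mod_cast (Nat.choose_pos (by omega)).ne'
      have hsq : ((-1 : ℝ) ^ (2 * k + 1 - i)) * (-1) ^ (2 * k + 1 - i) = 1 := by
        rw [← mul_pow]; simp
      have hsk : ((-1 : ℝ) ^ k) * (-1) ^ (k + 1) = -1 := by
        rw [pow_succ, ← mul_assoc, ← mul_pow]; simp
      have hf1 : (i.factorial : ℝ) ≠ 0 := by exact_mod_cast i.factorial_ne_zero
      have hf2 : ((2 * k + 1 - i).factorial : ℝ) ≠ 0 := by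
        exact_mod_cast (2 * k + 1 - i).factorial_ne_zero
      rw [hfac, ← hα' i hi]
      field_simp
      linear_combination (-α ((i : ℤ) - (k + 1)) * (a - i) ) * ((-1) ^ k * (-1) ^ (k + 1)) * hsq
        - α ((i : ℤ) - (k + 1)) * (a - i) * hsk
    · rw [Nat.choose_eq_zero_of_lt (by omega)]; simp

lemma one_add_sq_mul_one_add_pow_mul_exp_le (k : ℕ) {t : ℝ} (ht : 0 ≤ t) :
    (1 + t ^ 2) * (1 + t ^ (4 * k + 2)) * Real.exp (-(1 / (k + 1) * t ^ (2 * k + 2)))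
      ≤ 4 * (3 * (k + 1)) ^ 3 := by
  set x := t ^ (2 * k + 2) with hx
  have hx0 : 0 ≤ x := by positivity
  have hx2 : x ^ 2 = t ^ (4 * k + 4) := by rw [hx, ← pow_mul]; ring_nf
  have h1 : t ^ 2 ≤ 1 + x := by
    rcases le_total t 1 with h | h
    · linarith [pow_le_one₀ (n := 2) ht h]
    · linarith [pow_le_pow_right₀ h (by omega : 2 ≤ 2 * k + 2)]
  have h2 : t ^ (4 * k + 2) ≤ 1 + x ^ 2 := by
    rw [hx2]
    rcases le_total t 1 with h | h
    · linarith [pow_le_one₀ (n := 4 * k + 2) ht h, pow_nonneg ht (4 * k + 4)]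
    · linarith [pow_le_pow_right₀ h (by omega : 4 * k + 2 ≤ 4 * k + 4)]
  have h3 : 1 + x ≤ 3 * (k + 1) * Real.exp (1 / (k + 1) * x / 3) := by
    have hk : (0 : ℝ) ≤ k := k.cast_nonneg
    have h := Real.add_one_le_exp (1 / (k + 1) * x / 3)
    have : 3 * ((k : ℝ) + 1) * (1 / (k + 1) * x / 3 + 1) = x + 3 * (k + 1) := by
      field_simp
    nlinarith
  have h4 : (1 + x) ^ 3 ≤ (3 * (k + 1)) ^ 3 * Real.exp (1 / (k + 1) * x) := by
    refine (pow_le_pow_left₀ (by linarith) h3 3).trans_eq ?_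
    rw [mul_pow, ← Real.exp_nat_mul]
    congr 2; push_cast; ring
  have h5 : (1 + t ^ 2) * (1 + t ^ (4 * k + 2)) ≤ 4 * (1 + x) ^ 3 := by
    calc _ ≤ (1 + (1 + x)) * (1 + (1 + x ^ 2)) := by gcongr
      _ ≤ _ := by nlinarith [mul_nonneg hx0 hx0, pow_nonneg hx0 3]
  rw [Real.exp_neg, ← div_eq_mul_inv, div_le_iff₀ (Real.exp_pos _)]
  linarith

open Polynomial in
lemma norm_aeval_exp_pow_sq_add_le {k n : ℕ} {c l θ : ℝ} {B P : ℝ[X]} (hc : 0 ≤ c) (hl : 0 < l)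
    (hlQ : l ^ (2 * k + 2) * (n * c + 1) = 1) (hθ : |θ| ≤ Real.pi)
    (hr : ‖aeval (Complex.exp (θ * Complex.I)) B‖ ^ 2
      ≤ 1 - 1 / (k + 1) * c * Real.sin (θ / 2) ^ (2 * k + 2))
    (hPB : P = C (n : ℝ) * B ^ (n - 1) * (C ((-1) ^ k * c) * (X - 1) ^ (2 * k + 1))) :
    ‖aeval (Complex.exp (θ * Complex.I)) (B ^ n)‖ ^ 2
        + l ^ 2 * ‖aeval (Complex.exp (θ * Complex.I)) P‖ ^ 2
      ≤ (1 + 4 ^ (2 * k + 1)) * (Real.exp 2 * (4 * (3 * (k + 1)) ^ 3) * Real.pi ^ 2)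
        * (1 / (1 + (θ / l) ^ 2)) := by
  have hpi := Real.pi_pos
  set M : ℝ := Real.exp 2 * (4 * (3 * (k + 1)) ^ 3) * Real.pi ^ 2 with hM
  set Q : ℝ := n * c + 1 with hQ
  set r := ‖aeval (Complex.exp (θ * Complex.I)) B‖ ^ 2 with hr_def
  have hr0 : 0 ≤ r := sq_nonneg _
  set s := |Real.sin (θ / 2)| with hs
  have hs0 : 0 ≤ s := abs_nonneg _
  have hs1 : s ≤ 1 := Real.abs_sin_le_one _
  have hseven : Real.sin (θ / 2) ^ (2 * k + 2) = s ^ (2 * k + 2) :=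
    (Even.pow_abs ⟨k + 1, by ring⟩ _).symm
  rw [hseven] at hr
  have hsθ : |θ| ≤ Real.pi * s := by
    have h := Real.mul_le_sin (x := |θ| / 2) (by positivity) (by linarith)
    have h2 : Real.sin (|θ| / 2) ≤ s := by
      rw [hs]
      rcases abs_cases θ with ⟨h, -⟩ | ⟨h, -⟩ <;> rw [h]
      · exact le_abs_self _
      · rw [neg_div, Real.sin_neg]; exact neg_le_abs _
    have h3 : |θ| = Real.pi * (2 / Real.pi * (|θ| / 2)) := by field_simp
    rw [h3]
    exact mul_le_mul_of_nonneg_left (h.trans h2) hpi.le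
  set t := s / l with ht
  have ht0 : 0 ≤ t := by positivity
  have hst : s = t * l := by rw [ht]; field_simp
  have hx : t ^ (2 * k + 2) = Q * s ^ (2 * k + 2) := by
    rw [hst, mul_pow]; linear_combination (-t ^ (2 * k + 2)) * hlQ
  set u := 1 / (k + 1) * c * s ^ (2 * k + 2) with hu
  have hu0 : 0 ≤ u := by positivity
  have hκ : 1 / ((k : ℝ) + 1) * s ^ (2 * k + 2) ≤ 1 :=
    mul_le_one₀ (by rw [div_le_one (by positivity)]; linarith [k.cast_nonneg (α := ℝ)])
      (by positivity) (pow_le_one₀ hs0 hs1)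
  have hdecay : r ^ (n - 1) ≤ Real.exp 2 * Real.exp (-(1 / (k + 1) * t ^ (2 * k + 2))) := by
    have h1 : r ≤ Real.exp (-u) := by linarith [Real.add_one_le_exp (-u)]
    refine (pow_le_pow_left₀ hr0 h1 _).trans ?_
    rw [← Real.exp_nat_mul, ← Real.exp_add, Real.exp_le_exp, hx]
    have h2 : (n : ℝ) ≤ ((n - 1 : ℕ) : ℝ) + 1 := by exact_mod_cast (by omega)
    have h3 : 1 / ((k : ℝ) + 1) * (Q * s ^ (2 * k + 2))
        = n * u + 1 / ((k : ℝ) + 1) * s ^ (2 * k + 2) := by rw [hQ, hu]; ring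
    rw [h3]
    nlinarith [mul_le_mul_of_nonneg_right h2 hu0]
  have hθt : 1 + (θ / l) ^ 2 ≤ Real.pi ^ 2 * (1 + t ^ 2) := by
    have h1 : (θ / l) ^ 2 ≤ (Real.pi * t) ^ 2 := by
      rw [← sq_abs (θ / l), abs_div, abs_of_pos hl, ht, ← mul_div_assoc]
      gcongr
    have : 1 ≤ Real.pi ^ 2 := one_le_pow₀ (by linarith [Real.pi_gt_three])
    nlinarith
  have hmain : r ^ (n - 1) * (1 + t ^ (4 * k + 2)) ≤ M * (1 / (1 + (θ / l) ^ 2)) := by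
    rw [mul_one_div, le_div_iff₀ (by positivity)]
    calc r ^ (n - 1) * (1 + t ^ (4 * k + 2)) * (1 + (θ / l) ^ 2)
        ≤ Real.exp 2 * Real.exp (-(1 / (k + 1) * t ^ (2 * k + 2))) * (1 + t ^ (4 * k + 2))
          * (Real.pi ^ 2 * (1 + t ^ 2)) := by gcongr
      _ = Real.exp 2 * ((1 + t ^ 2) * (1 + t ^ (4 * k + 2))
          * Real.exp (-(1 / (k + 1) * t ^ (2 * k + 2)))) * Real.pi ^ 2 := by ring
      _ ≤ M := by
          rw [hM]
          exact mul_le_mul_of_nonneg_right (mul_le_mul_of_nonneg_left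
            (one_add_sq_mul_one_add_pow_mul_exp_le k ht0) (Real.exp_pos 2).le) (sq_nonneg _)
  have hfirst : ‖aeval (Complex.exp (θ * Complex.I)) (B ^ n)‖ ^ 2 ≤ r ^ (n - 1) := by
    rw [map_pow, norm_pow, ← pow_mul, mul_comm n 2, pow_mul]
    exact pow_le_pow_of_le_one hr0 (by linarith) (Nat.sub_le _ _)
  have hz : ‖Complex.exp (θ * Complex.I) - 1‖ = 2 * s := by
    rw [mul_comm, Complex.norm_exp_I_mul_ofReal_sub_one, norm_mul, Real.norm_eq_abs,
      Real.norm_eq_abs, abs_two]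
  have hsecond : l ^ 2 * ‖aeval (Complex.exp (θ * Complex.I)) P‖ ^ 2
      ≤ 4 ^ (2 * k + 1) * (r ^ (n - 1) * t ^ (4 * k + 2)) := by
    have h1 : ‖aeval (Complex.exp (θ * Complex.I)) P‖ ^ 2
        = (n * c) ^ 2 * r ^ (n - 1) * (4 ^ (2 * k + 1) * s ^ (4 * k + 2)) := by
      have h2 : ‖((-1 : ℂ) ^ k)‖ = 1 := by simp
      rw [hPB]
      simp only [map_mul, map_pow, map_sub, aeval_X, map_one, aeval_C, norm_mul, norm_pow, hz,
        Complex.coe_algebraMap, Complex.norm_real, Real.norm_eq_abs, abs_neg, abs_one, one_pow,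
        one_mul, abs_of_nonneg hc, Nat.abs_cast, hr_def, mul_pow]
      rw [show (4 : ℝ) = 2 ^ 2 by norm_num]
      simp only [← pow_mul]
      ring_nf
    have h2 : l ^ 2 * (Q ^ 2 * s ^ (4 * k + 2)) = t ^ (4 * k + 2) := by
      have h3 : l ^ 2 * (Q ^ 2 * s ^ (4 * k + 2))
          = (l ^ (2 * k + 2) * Q) ^ 2 * t ^ (4 * k + 2) := by
        rw [hst, mul_pow, mul_pow (l ^ (2 * k + 2)), ← pow_mul]; ring
      rw [h3, hlQ]; ring
    have h4 : (n * c) ^ 2 ≤ Q ^ 2 := by gcongr; linarith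
    calc _ = (n * c) ^ 2 * (l ^ 2 * r ^ (n - 1) * (4 ^ (2 * k + 1) * s ^ (4 * k + 2))) := by
            rw [h1]; ring
      _ ≤ Q ^ 2 * (l ^ 2 * r ^ (n - 1) * (4 ^ (2 * k + 1) * s ^ (4 * k + 2))) := by gcongr
      _ = 4 ^ (2 * k + 1) * (r ^ (n - 1) * (l ^ 2 * (Q ^ 2 * s ^ (4 * k + 2)))) := by ring
      _ = _ := by rw [h2]
  have h5 : 0 ≤ r ^ (n - 1) := by positivity
  have h6 : 0 ≤ r ^ (n - 1) * t ^ (4 * k + 2) := by positivity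
  have h7 : (0 : ℝ) < 4 ^ (2 * k + 1) := by positivity
  calc _ ≤ r ^ (n - 1) + 4 ^ (2 * k + 1) * (r ^ (n - 1) * t ^ (4 * k + 2)) :=
        add_le_add hfirst hsecond
    _ ≤ (1 + 4 ^ (2 * k + 1)) * (r ^ (n - 1) * (1 + t ^ (4 * k + 2))) := by nlinarith
    _ ≤ (1 + 4 ^ (2 * k + 1)) * (M * (1 / (1 + (θ / l) ^ 2))) := by gcongr
    _ = _ := by ring

open Polynomial in
lemma exists_sum_abs_coeff_pow_le (k : ℕ) : ∃ D : ℝ, 0 < D ∧ ∀ (a c : ℝ) (B : ℝ[X]), 0 ≤ c →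
    (∀ θ : ℝ, |θ| ≤ Real.pi → ‖aeval (Complex.exp (θ * Complex.I)) B‖ ^ 2
      ≤ 1 - 1 / (k + 1) * c * Real.sin (θ / 2) ^ (2 * k + 2)) →
    X * derivative B - C a * B = C ((-1) ^ k * c) * (X - 1) ^ (2 * k + 1) →
    ∀ n N : ℕ, (B ^ n).natDegree < N → ∑ j ∈ Finset.range N, |(B ^ n).coeff j| ≤ D := by
  have hpi := Real.pi_pos
  obtain ⟨L, hL⟩ : ∃ L : ℝ, L = (1 + 4 ^ (2 * k + 1))
      * (Real.exp 2 * (4 * (3 * (k + 1)) ^ 3) * Real.pi ^ 2) := ⟨_, rfl⟩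
  have hL0 : 0 < L := hL ▸ by positivity
  refine ⟨1 + 3 * Real.pi * (L / 2), by positivity, ?_⟩
  intro a c B hc hρ hB n N hN
  set Q : ℝ := n * c + 1 with hQ
  have hQ1 : 1 ≤ Q := le_add_of_nonneg_left (by positivity)
  obtain ⟨l, hl, hl1, hlQ⟩ : ∃ l : ℝ, 0 < l ∧ l ≤ 1 ∧ l ^ (2 * k + 2) * Q = 1 := by
    refine ⟨Q⁻¹ ^ (((2 * k + 2 : ℕ) : ℝ)⁻¹), by positivity, ?_, ?_⟩
    · exact Real.rpow_le_one (by positivity) (inv_le_one_of_one_le₀ hQ1) (by positivity)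
    · rw [Real.rpow_inv_natCast_pow (by positivity) (by omega), inv_mul_cancel₀ (by positivity)]
  set P : ℝ[X] := X * derivative (B ^ n) - C (n * a) * B ^ n with hP
  have hPB : P = C (n : ℝ) * B ^ (n - 1) * (C ((-1) ^ k * c) * (X - 1) ^ (2 * k + 1)) := by
    rw [hP, ← hB, derivative_pow]
    rcases n with _ | n
    · simp
    · simp only [Nat.add_sub_cancel, pow_succ, C_mul]
      ring
  have hPcoeff : ∀ j, P.coeff j = (j - n * a) * (B ^ n).coeff j := by
    intro j
    have hX : (X * derivative (B ^ n)).coeff j = j * (B ^ n).coeff j := by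
      cases j with
      | zero => simp
      | succ i => rw [coeff_X_mul, coeff_derivative]; push_cast; ring
    rw [hP, coeff_sub, hX, coeff_C_mul]; ring
  have hPN : P.natDegree < N := by
    refine lt_of_le_of_lt (natDegree_le_iff_coeff_eq_zero.2 fun j hj => ?_) hN
    rw [hPcoeff, coeff_eq_zero_of_natDegree_lt hj, mul_zero]
  have hpt : ∀ θ : ℝ, |θ| ≤ Real.pi →
      ‖aeval (Complex.exp (θ * Complex.I)) (B ^ n)‖ ^ 2
        + l ^ 2 * ‖aeval (Complex.exp (θ * Complex.I)) P‖ ^ 2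
      ≤ L * (1 / (1 + (θ / l) ^ 2)) := fun θ hθ =>
    hL ▸ norm_aeval_exp_pow_sq_add_le hc hl hlQ hθ (hρ θ hθ) hPB
  have hcont : ∀ R : ℝ[X], Continuous fun θ : ℝ =>
      ‖aeval (Complex.exp (θ * Complex.I)) R‖ ^ 2 := fun R => by
    have : Continuous fun θ : ℝ => aeval (Complex.exp (θ * Complex.I)) R :=
      R.continuous_aeval.comp (by fun_prop)
    fun_prop
  have henergy : ∑ j ∈ Finset.range N,
      (B ^ n).coeff j ^ 2 * (1 + l ^ 2 * ((j : ℝ) - n * a) ^ 2) ≤ L / 2 * l := by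
    have hint : ∫ θ in (-Real.pi)..Real.pi, (‖aeval (Complex.exp (θ * Complex.I)) (B ^ n)‖ ^ 2
        + l ^ 2 * ‖aeval (Complex.exp (θ * Complex.I)) P‖ ^ 2) ≤ L * (Real.pi * l) := by
      have h1 : Continuous fun θ : ℝ => L * (1 / (1 + (θ / l) ^ 2)) := by
        refine continuous_const.mul (continuous_const.div (by fun_prop) fun θ => ?_)
        positivity
      refine (intervalIntegral.integral_mono_on (by linarith)
        (((hcont _).add (continuous_const.mul (hcont _))).intervalIntegrable _ _)
        (h1.intervalIntegrable _ _) fun θ hθ => hpt θ (abs_le.2 hθ)).trans ?_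
      rw [intervalIntegral.integral_const_mul]
      exact mul_le_mul_of_nonneg_left (integral_inv_one_add_sq_le hl _ _) hL0.le
    rw [intervalIntegral.integral_add ((hcont _).intervalIntegrable _ _)
      (((hcont _).intervalIntegrable _ _).const_mul _),
      intervalIntegral.integral_const_mul, integral_norm_aeval_exp_sq _ hN,
      integral_norm_aeval_exp_sq _ hPN] at hint
    have heq : ∑ j ∈ Finset.range N, (B ^ n).coeff j ^ 2 * (1 + l ^ 2 * ((j : ℝ) - n * a) ^ 2)
        = ∑ j ∈ Finset.range N, (B ^ n).coeff j ^ 2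
          + l ^ 2 * ∑ j ∈ Finset.range N, P.coeff j ^ 2 := by
      rw [Finset.mul_sum, ← Finset.sum_add_distrib]
      exact Finset.sum_congr rfl fun j _ => by rw [hPcoeff]; ring
    rw [heq]
    refine le_of_mul_le_mul_left ?_ (by positivity : 0 < 2 * Real.pi)
    linarith
  have hcs := Finset.sum_sq_le_sum_mul_sum_of_sq_le_mul (Finset.range N)
    (r := fun j => |(B ^ n).coeff j|)
    (f := fun j : ℕ => 1 / (1 + l ^ 2 * ((j : ℝ) - n * a) ^ 2))
    (g := fun j : ℕ => (B ^ n).coeff j ^ 2 * (1 + l ^ 2 * ((j : ℝ) - n * a) ^ 2))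
    (fun j _ => by positivity) (fun j _ => by positivity)
    (fun j _ => by
      have : 0 < 1 + l ^ 2 * ((j : ℝ) - n * a) ^ 2 := by positivity
      rw [sq_abs]; field_simp; rfl)
  have hsum := sum_inv_one_add_sq_le hl hl1 (n * a) N
  set S := ∑ j ∈ Finset.range N, |(B ^ n).coeff j|
  have hS : S ^ 2 ≤ 3 * Real.pi * (L / 2) := by
    refine hcs.trans ((mul_le_mul_of_nonneg_left henergy
      (Finset.sum_nonneg fun j _ => by positivity)).trans ?_)
    rw [mul_comm (L / 2), ← mul_assoc, mul_comm _ l]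
    exact mul_le_mul_of_nonneg_right hsum (by positivity)
  nlinarith [sq_nonneg (S - 1)]

/-- Translation of sequences by one index. -/
def shiftEnd : Module.End ℝ (ℤ → ℝ) := LinearMap.funLeft ℝ ℝ (· + 1)

lemma shiftEnd_pow_apply (i : ℕ) (c : ℤ → ℝ) (j : ℤ) : (shiftEnd ^ i) c j = c (j + i) := by
  induction i generalizing j with
  | zero => simp
  | succ i ih =>
    rw [pow_succ']
    change (shiftEnd ^ i) c (j + 1) = _
    rw [ih]; push_cast; congr 1; ring

open Polynomial in
lemma aeval_shiftEnd_apply (P : ℝ[X]) {N : ℕ} (hN : P.natDegree < N) (c : ℤ → ℝ) (j : ℤ) :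
    aeval shiftEnd P c j = ∑ i ∈ Finset.range N, P.coeff i * c (j + i) := by
  rw [aeval_eq_sum_range' hN, LinearMap.sum_apply, Finset.sum_apply]
  exact Finset.sum_congr rfl fun i _ => by simp [shiftEnd_pow_apply]

open Polynomial in
lemma iterate_eq_aeval_shiftEnd {H : (ℤ → ℝ) → ℤ → ℝ} {P : ℝ[X]} {m : ℤ}
    (hH : ∀ c j, H c j = aeval shiftEnd P c (j - m)) (n : ℕ) (c : ℤ → ℝ) (j : ℤ) :
    H^[n] c j = aeval shiftEnd (P ^ n) c (j - n * m) := by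
  induction n generalizing c j with
  | zero => simp
  | succ n ih =>
    have hc : H c = fun x => aeval shiftEnd P c (x - m) := funext (hH c)
    have htrans : ∀ (R : ℝ[X]) (d : ℤ → ℝ) (x : ℤ),
        aeval shiftEnd R (fun y => d (y - m)) x = aeval shiftEnd R d (x - m) := by
      intro R d x
      rw [aeval_shiftEnd_apply R (Nat.lt_succ_self _), aeval_shiftEnd_apply R (Nat.lt_succ_self _)]
      exact Finset.sum_congr rfl fun i _ => by congr 2; ring
    rw [Function.iterate_succ_apply, ih, hc, htrans, pow_succ, map_mul, Module.End.mul_apply]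
    push_cast; ring_nf

open Polynomial in
lemma eLpNorm_aeval_shiftEnd_le (P : ℝ[X]) {N : ℕ} (hN : P.natDegree < N) {q : ℝ≥0∞} (hq : 1 ≤ q)
    (c : ℤ → ℝ) (m : ℤ) :
    eLpNorm (fun j => aeval shiftEnd P c (j - m)) q Measure.count
      ≤ ENNReal.ofReal (∑ i ∈ Finset.range N, |P.coeff i|) * eLpNorm c q Measure.count := by
  have hfun : (fun j => aeval shiftEnd P c (j - m))
      = ∑ i ∈ Finset.range N, P.coeff i • (c ∘ fun j => j + ((i : ℤ) - m)) := by
    ext j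
    rw [aeval_shiftEnd_apply P hN, Finset.sum_apply]
    refine Finset.sum_congr rfl fun i _ => ?_
    simp only [Pi.smul_apply, Function.comp, smul_eq_mul]
    congr 2; ring
  rw [hfun, ENNReal.ofReal_sum_of_nonneg fun _ _ => abs_nonneg _, Finset.sum_mul]
  refine (eLpNorm_sum_le (fun _ _ => measurable_of_countable _ |>.aestronglyMeasurable) hq).trans
    (Finset.sum_le_sum fun i _ => ?_)
  rw [eLpNorm_const_smul, eLpNorm_comp_measurePreserving
    (measurable_of_countable _).aestronglyMeasurable (measurePreserving_add_right _ _),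
    Real.enorm_eq_ofReal_abs]

/-- L^q stability of odd-order IS-schemes: for `p = 2k+1`, the unique order-`p`
scheme on the stencil `{k−p, …, k}` satisfies `‖c^n‖_{ℓ^q} ≤ D_p ‖c^0‖_{ℓ^q}` for all
`q ∈ [1,∞]`, all `ν ∈ (0,1]`, all initial data `c^0 ∈ ℓ^q(ℤ)` and all iterates `n`,
with a constant `D_p > 0` depending only on `p`. -/
theorem odd_order_IS_scheme_Lq_stability
    (k p : ℕ) (hp : p = 2 * k + 1) :
    ∃ D : ℝ, 0 < D ∧
      ∀ ν ∈ Set.Ioc (0 : ℝ) 1, ∀ α : ℤ → ℝ,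
        (∀ m : ℕ, m ≤ p →
          ∑ r ∈ Finset.Icc ((k : ℤ) - (p : ℤ)) (k : ℤ), α r * (r : ℝ) ^ m = (-ν) ^ m) →
        ∀ q : ℝ≥0∞, 1 ≤ q →
        ∀ c0 : ℤ → ℝ, eLpNorm c0 q (Measure.count) ≠ ⊤ →
        ∀ n : ℕ,
          eLpNorm
            ((fun c : ℤ → ℝ => fun j : ℤ =>
              ∑ r ∈ Finset.Icc ((k : ℤ) - (p : ℤ)) (k : ℤ), α r * c (j + r))^[n] c0)
            q (Measure.count)
          ≤ ENNReal.ofReal D * eLpNorm c0 q (Measure.count) := by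
  subst hp
  obtain ⟨D, hD, hbound⟩ := exists_sum_abs_coeff_pow_le k
  refine ⟨D, hD, fun ν hν α hα q hq c0 _ n => ?_⟩
  simp_rw [sum_Icc_eq_sum_range] at hα ⊢
  obtain ⟨B, hB⟩ : ∃ B : Polynomial ℝ, B = ∑ i ∈ Finset.range (2 * k + 2),
      Polynomial.C (α ((i : ℤ) - (k + 1))) * Polynomial.X ^ i := ⟨_, rfl⟩
  obtain ⟨c, hc, hy, hBc⟩ := exists_X_mul_derivative_sub_eq hν hα hB
  have hcoeff : ∀ i < 2 * k + 2, B.coeff i = α ((i : ℤ) - (k + 1)) := by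
    intro i hi
    simp [hB, Polynomial.coeff_X_pow, hi]
  have hdeg : B.natDegree < 2 * k + 2 := by
    rw [hB]
    refine Nat.lt_succ_of_le (Polynomial.natDegree_sum_le_of_forall_le _ _ fun i hi => ?_)
    exact (Polynomial.natDegree_C_mul_X_pow_le _ _).trans (Nat.lt_succ_iff.1 (Finset.mem_range.1 hi))
  have hB1 : B.eval 1 = 1 := by
    simpa [hB, Polynomial.eval_finsetSum] using hα 0 (Nat.zero_le _)
  have hH := iterate_eq_aeval_shiftEnd (P := B) (m := k + 1)
    (H := fun c j => ∑ i ∈ Finset.range (2 * k + 2),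
      α ((i : ℤ) - (k + 1)) * c (j + ((i : ℤ) - (k + 1)))) (fun d j => by
      rw [aeval_shiftEnd_apply B hdeg]
      refine Finset.sum_congr rfl fun i hi => ?_
      rw [hcoeff i (Finset.mem_range.1 hi)]
      congr 2; ring) n c0
  rw [funext hH]
  refine (eLpNorm_aeval_shiftEnd_le _ (Nat.lt_succ_self _) hq c0 _).trans ?_
  gcongr
  exact hbound _ c B hc (fun θ hθ => norm_aeval_exp_sq_le hy hc hB1 hBc hθ) hBc n _
    (Nat.lt_succ_self _)
end

section
/- (Non-emptiness of the anti-diffusive flux interval in the Lagrange-Remap two-fluid scheme.) Let Y_{j−1}, Y_j, Y_{j+1} ∈ ℝ, let u_{j+1/2} > 0, Δt > 0, Δx > 0 satisfy the CFL condition u_{j+1/2}Δt/Δx < 1, and consider the case u_{j−1/2} > 0. Set 𝔪_{j−1/2} = min(Y_{j−1}, Y_j), 𝔐_{j−1/2} = max(Y_{j−1}, Y_j), 𝔪_{j+1/2} = min(Y_j, Y_{j+1}), 𝔐_{j+1/2} = max(Y_j, Y_{j+1}), d_{j+1/2} = Y_j + (𝔐_{j−1/2} − Y_j)(1 − Δx/(u_{j+1/2}Δt))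 and D_{j+1/2} = Y_j + (𝔪_{j−1/2} − Y_j)(1 − Δx/(u_{j+1/2}Δt)). Then d_{j+1/2} ≤ Y_j ≤ D_{j+1/2} and 𝔪_{j+1/2} ≤ Y_j ≤ 𝔐_{j+1/2}; consequently Y_j belongs to [𝔪_{j+1/2}, 𝔐_{j+1/2}] ∩ [d_{j+1/2}, D_{j+1/2}], so this intersection [ω_{j+1/2}, Ω_{j+1/2}] is nonempty. -/
/-- non-emptiness of the anti-diffusive flux interval in the Lagrange-Remap
two-fluid scheme: in the case `u_{j−1/2} > 0`, `u_{j+1/2} > 0` with CFL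
`u_{j+1/2}Δt/Δx < 1`, one has `d_{j+1/2} ≤ Y_j ≤ D_{j+1/2}` and
`𝔪_{j+1/2} ≤ Y_j ≤ 𝔐_{j+1/2}`, so `Y_j ∈ [𝔪_{j+1/2}, 𝔐_{j+1/2}] ∩ [d_{j+1/2}, D_{j+1/2}]`
and this intersection is nonempty. -/
theorem lagrange_remap_flux_interval_nonempty
    (Yjm Yj Yjp : ℝ) (ujm ujp Δt Δx : ℝ)
    (hujm : 0 < ujm) (hujp : 0 < ujp) (hΔt : 0 < Δt) (hΔx : 0 < Δx)
    (hCFL : ujp * Δt / Δx < 1)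
    (mjm Mjm mjp Mjp d D : ℝ)
    (hmjm : mjm = min Yjm Yj) (hMjm : Mjm = max Yjm Yj)
    (hmjp : mjp = min Yj Yjp) (hMjp : Mjp = max Yj Yjp)
    (hd : d = Yj + (Mjm - Yj) * (1 - Δx / (ujp * Δt)))
    (hD : D = Yj + (mjm - Yj) * (1 - Δx / (ujp * Δt))) :
    d ≤ Yj ∧ Yj ≤ D ∧ mjp ≤ Yj ∧ Yj ≤ Mjp ∧
    Yj ∈ Set.Icc mjp Mjp ∩ Set.Icc d D ∧
    (Set.Icc mjp Mjp ∩ Set.Icc d D).Nonempty := by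
  have hratio : 1 - Δx / (ujp * Δt) ≤ 0 := by
    rw [sub_nonpos, one_le_div (mul_pos hujp hΔt)]
    exact ((div_lt_one hΔx).mp hCFL).le
  have hM : 0 ≤ Mjm - Yj := sub_nonneg.mpr (hMjm ▸ le_max_right _ _)
  have hm : mjm - Yj ≤ 0 := sub_nonpos.mpr (hmjm ▸ min_le_right _ _)
  have h₁ : d ≤ Yj := by
    linarith [mul_nonpos_of_nonneg_of_nonpos hM hratio]
  have h₂ : Yj ≤ D := by
    linarith [mul_nonneg_of_nonpos_of_nonpos hm hratio]
  have h₃ : mjp ≤ Yj := hmjp ▸ min_le_left _ _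
  have h₄ : Yj ≤ Mjp := hMjp ▸ le_max_left _ _
  have hmem : Yj ∈ Set.Icc mjp Mjp ∩ Set.Icc d D := ⟨⟨h₃, h₄⟩, h₁, h₂⟩
  exact ⟨h₁, h₂, h₃, h₄, hmem, Yj, hmem⟩
end
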